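/- arXiv:1703.02636 — 3 statements merged into one kernel-verified Lean document; each statement's English description precedes it below -/
import Mathlib

section
/- Let γ ∈ (0,1), let f ∈ C¹(α, β) with f′ locally Lipschitz on (α, β), let u₀ ∈ (α, β), and let u be the unique solution of D_c^γ u = f(u), u(0) = u₀, on its maximal interval [0, T_b). Then u is continuous on [0, T_b) and continuously differentiable on (0, T_b), and y = u′ satisfies the integral equation y(t) = (f(u₀)/Γ(γ)) t^{γ−1} + (1/Γ(γ)) ∫₀ᵗ s^{γ−1} f′(u(t−s)) y(t−s) ds for all t ∈ (0, T_b). Moreover u′(t) = O(t^{γ−1}) as t → 0⁺, and if f(u₀) ≠ 0 then u′(t)/( (f(u₀)/Γ(γ)) t^{γ−1} ) → 1 as t → 0⁺. -/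
open MeasureTheory Real Filter Set Asymptotics
open scoped ENNReal Topology

/-- `u` is a solution of the Volterra integral form of the fractional ODE
`D_c^γ u = f(u)`, `u(0) = u₀`, on the interval `[0, T)` (with `T ∈ (0,∞]`),
taking values in the set `D`. -/
noncomputable def IsSolUpTo (γ : ℝ) (f : ℝ → ℝ) (D : Set ℝ) (u₀ : ℝ) (u : ℝ → ℝ)
    (T : ℝ≥0∞) : Prop :=
  u 0 = u₀ ∧
  ContinuousOn u {t : ℝ | 0 ≤ t ∧ ENNReal.ofReal t < T} ∧
  (∀ t : ℝ, 0 ≤ t → ENNReal.ofReal t < T → u t ∈ D) ∧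
  (∀ t : ℝ, 0 ≤ t → ENNReal.ofReal t < T →
    u t = u₀ + (1 / Real.Gamma γ) * ∫ s in (0:ℝ)..t, (t - s) ^ (γ - 1) * f (u s))

/-- The maximal existence time `T_b`: the supremum of all `T` such that a solution
exists on `[0, T)`. -/
noncomputable def maxTime (γ : ℝ) (f : ℝ → ℝ) (D : Set ℝ) (u₀ : ℝ) : ℝ≥0∞ :=
  sSup {T : ℝ≥0∞ | ∃ u : ℝ → ℝ, IsSolUpTo γ f D u₀ u T}


lemma kerI (γ : ℝ) (hγ : 0 < γ) (t a b : ℝ) :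
    IntervalIntegrable (fun s : ℝ => (t - s) ^ (γ - 1)) volume a b := by
  have h := (intervalIntegral.intervalIntegrable_rpow' (a := t - a) (b := t - b) (r := γ - 1)
    (by linarith)).comp_sub_left t
  simpa using h

lemma betaI (γ μ : ℝ) (hγ : 0 < γ) (hμ : 0 < μ) (t : ℝ) (ht : 0 < t) :
    IntervalIntegrable (fun s : ℝ => (t - s) ^ (γ - 1) * s ^ (μ - 1)) volume 0 t := by
  apply IntervalIntegrable.trans (b := t / 2)
  · have h1 : IntervalIntegrable (fun s : ℝ => s ^ (μ - 1)) volume 0 (t / 2) :=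
      intervalIntegral.intervalIntegrable_rpow' (by linarith)
    have h2 : ContinuousOn (fun s : ℝ => (t - s) ^ (γ - 1)) (uIcc 0 (t / 2)) := by
      intro s hs
      rw [uIcc_of_le (by linarith)] at hs
      have : t - s ≠ 0 := by
        have := hs.2
        intro h
        linarith
      apply ContinuousAt.continuousWithinAt
      apply ContinuousAt.rpow_const (by fun_prop) (Or.inl this)
    have h3 := h1.mul_continuousOn h2
    simpa only [mul_comm] using h3
  · have h2 : ContinuousOn (fun s : ℝ => s ^ (μ - 1)) (uIcc (t / 2) t) := by
      intro s hs
      rw [uIcc_of_le (by linarith)] at hs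
      have : s ≠ 0 := by
        have := hs.1
        intro h
        linarith
      apply ContinuousAt.continuousWithinAt
      apply ContinuousAt.rpow_const (by fun_prop) (Or.inl this)
    exact (kerI γ hγ t _ _).mul_continuousOn h2

noncomputable def Bc (γ μ : ℝ) : ℝ := ∫ s in (0:ℝ)..1, (1 - s) ^ (γ - 1) * s ^ (μ - 1)

lemma Bc_nonneg (γ μ : ℝ) : 0 ≤ Bc γ μ := by
  apply intervalIntegral.integral_nonneg zero_le_one
  intro s hs
  have := hs.1
  have : 0 ≤ 1 - s := by linarith [hs.2]
  positivity

lemma beta_scaled (γ μ : ℝ) (t : ℝ) (ht : 0 < t) :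
    ∫ s in (0:ℝ)..t, (t - s) ^ (γ - 1) * s ^ (μ - 1) = Bc γ μ * t ^ (γ + μ - 1) := by
  have h := intervalIntegral.integral_comp_mul_left (a := 0) (b := 1)
    (fun s : ℝ => (t - s) ^ (γ - 1) * s ^ (μ - 1)) ht.ne'
  simp only [mul_zero, mul_one, smul_eq_mul] at h
  have h2 : ∫ x in (0:ℝ)..1, (t - t * x) ^ (γ - 1) * (t * x) ^ (μ - 1) =
      t ^ (γ + μ - 2) * Bc γ μ := by
    rw [Bc, ← intervalIntegral.integral_const_mul]
    apply intervalIntegral.integral_congr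
    intro x hx
    rw [uIcc_of_le zero_le_one] at hx
    have hx1 : 0 ≤ 1 - x := by linarith [hx.2]
    have e : t - t * x = t * (1 - x) := by ring
    simp only
    rw [e, Real.mul_rpow ht.le hx1, Real.mul_rpow ht.le hx.1,
      show γ + μ - 2 = (γ - 1) + (μ - 1) by ring, Real.rpow_add ht]
    ring
  rw [h2] at h
  have h3 : t ^ (γ + μ - 1) = t ^ (γ + μ - 2) * t := by
    rw [show γ + μ - 1 = (γ + μ - 2) + 1 by ring, Real.rpow_add ht, Real.rpow_one]
  rw [h3]
  field_simp at h
  linarith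

lemma exp_bound (x p : ℝ) (hx : 0 < x) (hp : 0 ≤ p) (hp1 : p ≤ 1) :
    Real.exp (-x) ≤ x ^ (-p) := by
  rw [Real.exp_neg, Real.rpow_neg hx.le]
  apply inv_anti₀ (by positivity)
  have h1 := Real.add_one_le_exp x
  rcases le_total x 1 with h | h
  · have := Real.rpow_le_one hx.le h hp
    linarith
  · have := Real.rpow_le_rpow_of_exponent_le h hp1
    rw [Real.rpow_one] at this
    linarith

lemma expI (γ μ L : ℝ) (hγ : 0 < γ) (hμ : 0 < μ) (t : ℝ) (ht : 0 < t) :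
    IntervalIntegrable (fun s : ℝ => (t - s) ^ (γ - 1) * (s ^ (μ - 1) * Real.exp (L * s)))
      volume 0 t := by
  have := (betaI γ μ hγ hμ t ht).mul_continuousOn (g := fun s => Real.exp (L * s))
    (by fun_prop)
  simpa only [mul_assoc] using this

lemma exp_smooth (γ μ L : ℝ) (hγ : 0 < γ) (hγ1 : γ ≤ 1) (hμ : 0 < μ) (hL : 0 < L)
    (t : ℝ) (ht : 0 < t) :
    ∫ s in (0:ℝ)..t, (t - s) ^ (γ - 1) * (s ^ (μ - 1) * Real.exp (L * s)) ≤
      L ^ (-(γ / 2)) * Bc (γ / 2) μ * t ^ (γ / 2) * (t ^ (μ - 1) * Real.exp (L * t)) := by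
  have key : ∫ s in (0:ℝ)..t, (t - s) ^ (γ - 1) * (s ^ (μ - 1) * Real.exp (L * s)) ≤
      ∫ s in (0:ℝ)..t, (L ^ (-(γ / 2)) * Real.exp (L * t)) *
        ((t - s) ^ (γ / 2 - 1) * s ^ (μ - 1)) := by
    apply intervalIntegral.integral_mono_on_of_le_Ioo ht.le (expI γ μ L hγ hμ t ht)
      ((betaI (γ / 2) μ (by linarith) hμ t ht).const_mul _)
    intro s hs
    have hts : 0 < t - s := by linarith [hs.2]
    have hs0 := hs.1
    have h1 := exp_bound (L * (t - s)) (γ / 2) (by positivity) (by linarith) (by linarith)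
    rw [Real.mul_rpow hL.le hts.le] at h1
    have h2 : Real.exp (L * s) = Real.exp (L * t) * Real.exp (-(L * (t - s))) := by
      rw [← Real.exp_add]
      ring_nf
    have h3 : (t - s) ^ (γ / 2 - 1) = (t - s) ^ (γ - 1) * (t - s) ^ (-(γ / 2)) := by
      rw [← Real.rpow_add hts]
      ring_nf
    rw [h2, h3]
    have h4 : 0 ≤ (t - s) ^ (γ - 1) * s ^ (μ - 1) * Real.exp (L * t) := by positivity
    calc _ = (t - s) ^ (γ - 1) * s ^ (μ - 1) * Real.exp (L * t) * Real.exp (-(L * (t - s))) := by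
            ring
      _ ≤ _ := mul_le_mul_of_nonneg_left h1 h4
      _ = _ := by ring
  refine key.trans (le_of_eq ?_)
  rw [intervalIntegral.integral_const_mul, beta_scaled _ _ t ht,
    show γ / 2 + μ - 1 = γ / 2 + (μ - 1) by ring, Real.rpow_add ht]
  ring

lemma gronwall (γ μ C T : ℝ) (hγ : 0 < γ) (hγ1 : γ ≤ 1) (hμ : 0 < μ) (hμ1 : μ < 1)
    (hC : 0 ≤ C) (hT : 0 < T) :
    ∃ M : ℝ, 0 < M ∧ ∀ φ : ℝ → ℝ, Continuous φ → ∀ ε : ℝ, 0 ≤ ε →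
      (∀ t ∈ Ioc 0 T, |φ t| ≤ ε * t ^ (μ - 1) +
        C * ∫ s in (0:ℝ)..t, (t - s) ^ (γ - 1) * |φ s|) →
      ∀ t ∈ Ioc 0 T, |φ t| ≤ M * ε * t ^ (μ - 1) := by
  -- choose L
  obtain ⟨L, hL, hLs⟩ : ∃ L : ℝ, 0 < L ∧
      C * (L ^ (-(γ / 2)) * Bc (γ / 2) μ * T ^ (γ / 2)) ≤ 1 / 2 := by
    have h1 : Tendsto (fun L : ℝ => C * (L ^ (-(γ / 2)) * Bc (γ / 2) μ * T ^ (γ / 2)))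
        atTop (𝓝 (C * (0 * Bc (γ / 2) μ * T ^ (γ / 2)))) :=
      (((tendsto_rpow_neg_atTop (by linarith)).mul_const _).mul_const _).const_mul _
    have h2 := h1.eventually_le_const (u := 1 / 2) (by norm_num)
    obtain ⟨L, hL1, hL2⟩ := (h2.and (eventually_gt_atTop 0)).exists
    exact ⟨L, hL2, hL1⟩
  refine ⟨2 * Real.exp (L * T), by positivity, ?_⟩
  intro φ hφ ε hε h t ht
  let ψ : ℝ → ℝ := fun s => Real.exp (-(L * s)) * s ^ (1 - μ) * |φ s|
  have hψc : ContinuousOn ψ (Icc 0 T) := by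
    have : Continuous fun s : ℝ => s ^ (1 - μ) :=
      Real.continuous_rpow_const (by linarith)
    apply Continuous.continuousOn
    fun_prop
  obtain ⟨t0, ht0, hmax⟩ := isCompact_Icc.exists_isMaxOn ⟨0, left_mem_Icc.2 hT.le⟩ hψc
  have hφψ : ∀ s : ℝ, 0 < s → |φ s| = ψ s * (s ^ (μ - 1) * Real.exp (L * s)) := by
    intro s hs
    have e1 : Real.exp (-(L * s)) * Real.exp (L * s) = 1 := by
      rw [← Real.exp_add]; simp
    have e2 : s ^ (1 - μ) * s ^ (μ - 1) = 1 := by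
      rw [← Real.rpow_add hs]; simp
    calc |φ s| = |φ s| * 1 * 1 := by ring
      _ = |φ s| * (Real.exp (-(L * s)) * Real.exp (L * s)) * (s ^ (1 - μ) * s ^ (μ - 1)) := by
        rw [e1, e2]
      _ = _ := by simp only [ψ]; ring
  have hψ0 : ∀ s : ℝ, 0 ≤ s → 0 ≤ ψ s := by
    intro s hs
    simp only [ψ]
    positivity
  have hB : ψ t0 ≤ 2 * ε := by
    rcases eq_or_lt_of_le ht0.1 with h0 | h0
    · have : ψ t0 = 0 := by
        simp only [ψ]
        rw [← h0, Real.zero_rpow (by linarith)]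
        simp
      linarith
    · have h1 := h t0 ⟨h0, ht0.2⟩
      have h2 : ∫ s in (0:ℝ)..t0, (t0 - s) ^ (γ - 1) * |φ s| ≤
          ∫ s in (0:ℝ)..t0, ψ t0 * ((t0 - s) ^ (γ - 1) * (s ^ (μ - 1) * Real.exp (L * s))) := by
        apply intervalIntegral.integral_mono_on_of_le_Ioo h0.le
          ((kerI γ hγ t0 _ _).mul_continuousOn (by fun_prop))
          ((expI γ μ L hγ hμ t0 h0).const_mul _)
        intro s hs
        have hs0 := hs.1
        have hts : 0 < t0 - s := by linarith [hs.2]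
        rw [hφψ s hs.1]
        have h3 : ψ s ≤ ψ t0 := hmax ⟨hs.1.le, by linarith [hs.2, ht0.2]⟩
        have h4 : 0 ≤ (t0 - s) ^ (γ - 1) * (s ^ (μ - 1) * Real.exp (L * s)) := by positivity
        nlinarith [mul_le_mul_of_nonneg_right h3 h4]
      rw [intervalIntegral.integral_const_mul] at h2
      have h3 := exp_smooth γ μ L hγ hγ1 hμ hL t0 h0
      have hψt0 := hψ0 t0 h0.le
      have h5 : t0 ^ (γ / 2) ≤ T ^ (γ / 2) := Real.rpow_le_rpow h0.le ht0.2 (by linarith)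
      set W := t0 ^ (μ - 1) * Real.exp (L * t0) with hW
      have hWpos : 0 < W := by positivity
      have hBn := Bc_nonneg (γ / 2) μ
      have h6 : C * ∫ s in (0:ℝ)..t0, (t0 - s) ^ (γ - 1) * |φ s| ≤ ψ t0 * (1 / 2) * W := by
        calc _ ≤ C * (ψ t0 * (L ^ (-(γ / 2)) * Bc (γ / 2) μ * t0 ^ (γ / 2) * W)) := by
              apply mul_le_mul_of_nonneg_left _ hC
              exact h2.trans (mul_le_mul_of_nonneg_left h3 hψt0)
          _ ≤ C * (ψ t0 * (L ^ (-(γ / 2)) * Bc (γ / 2) μ * T ^ (γ / 2) * W)) := by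
              gcongr
          _ = ψ t0 * (C * (L ^ (-(γ / 2)) * Bc (γ / 2) μ * T ^ (γ / 2))) * W := by ring
          _ ≤ _ := by gcongr
      rw [hφψ t0 h0] at h1
      have h7 : ε * t0 ^ (μ - 1) ≤ ε * W := by
        apply mul_le_mul_of_nonneg_left _ hε
        rw [hW]
        apply le_mul_of_one_le_right (by positivity)
        apply Real.one_le_exp
        positivity
      have h8 : ψ t0 * W ≤ (ε + ψ t0 / 2) * W := by linarith
      have := le_of_mul_le_mul_right h8 hWpos
      linarith
  rw [hφψ t ht.1]
  have h1 : ψ t ≤ ψ t0 := hmax ⟨ht.1.le, ht.2⟩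
  have h2 : Real.exp (L * t) ≤ Real.exp (L * T) := by
    apply Real.exp_le_exp.2
    exact mul_le_mul_of_nonneg_left ht.2 hL.le
  have ht0 := ht.1
  calc ψ t * (t ^ (μ - 1) * Real.exp (L * t)) ≤ (2 * ε) * (t ^ (μ - 1) * Real.exp (L * T)) := by
        gcongr
        linarith
    _ = _ := by ring

noncomputable def DQ (u : ℝ → ℝ) (h t : ℝ) : ℝ := (u (t + h) - u t) / h

noncomputable def GQ (γ : ℝ) (F : ℝ → ℝ) (h t : ℝ) : ℝ :=
  h⁻¹ * ∫ s in (0:ℝ)..h, (t + h - s) ^ (γ - 1) * F s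

lemma DQ_cont (u : ℝ → ℝ) (hu : Continuous u) (h : ℝ) : Continuous (DQ u h) := by
  unfold DQ
  fun_prop

lemma DQ_eq (γ c T : ℝ) (hγ : 0 < γ) (u F : ℝ → ℝ) (hF : Continuous F)
    (heq : ∀ t ∈ Icc 0 T, u t = c + (1 / Real.Gamma γ) *
      ∫ s in (0:ℝ)..t, (t - s) ^ (γ - 1) * F s)
    (h t : ℝ) (hh : 0 < h) (ht : 0 ≤ t) (hth : t + h ≤ T) :
    DQ u h t = (1 / Real.Gamma γ) * GQ γ F h t +
      (1 / Real.Gamma γ) * ∫ s in (0:ℝ)..t, (t - s) ^ (γ - 1) * DQ F h s := by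
  have I : ∀ t a b : ℝ, IntervalIntegrable (fun s => (t - s) ^ (γ - 1) * F s) volume a b :=
    fun t a b => (kerI γ hγ t a b).mul_continuousOn hF.continuousOn
  have e1 : ∫ s in (0:ℝ)..(t + h), (t + h - s) ^ (γ - 1) * F s =
      (∫ s in (0:ℝ)..h, (t + h - s) ^ (γ - 1) * F s) +
      ∫ s in (0:ℝ)..t, (t - s) ^ (γ - 1) * F (s + h) := by
    rw [← intervalIntegral.integral_add_adjacent_intervals (I (t + h) 0 h) (I (t + h) h (t + h))]
    congr 1
    have := intervalIntegral.integral_comp_add_right (a := 0) (b := t)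
      (fun s => (t + h - s) ^ (γ - 1) * F s) h
    rw [zero_add] at this
    rw [← this]
    congr 1
    ext s
    congr 2
    ring
  have e2 : ∫ s in (0:ℝ)..t, (t - s) ^ (γ - 1) * DQ F h s =
      h⁻¹ * ((∫ s in (0:ℝ)..t, (t - s) ^ (γ - 1) * F (s + h)) -
        ∫ s in (0:ℝ)..t, (t - s) ^ (γ - 1) * F s) := by
    rw [← intervalIntegral.integral_sub
      ((kerI γ hγ t _ _).mul_continuousOn (by fun_prop)) (I t _ _),
      ← intervalIntegral.integral_const_mul]
    congr 1
    ext s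
    simp only [DQ]
    ring
  rw [e2, DQ, GQ, heq (t + h) ⟨by linarith, hth⟩, heq t ⟨ht, by linarith⟩, e1]
  ring

lemma GQ_bound (γ Fm : ℝ) (hγ1 : γ ≤ 1) (F : ℝ → ℝ) (h t : ℝ) (hh : 0 < h) (ht : 0 < t)
    (hF : ∀ s ∈ Icc 0 h, |F s| ≤ Fm) : |GQ γ F h t| ≤ Fm * t ^ (γ - 1) := by
  have h1 : ‖∫ s in (0:ℝ)..h, (t + h - s) ^ (γ - 1) * F s‖ ≤ (Fm * t ^ (γ - 1)) * |h - 0| := by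
    apply intervalIntegral.norm_integral_le_of_norm_le_const
    intro s hs
    rw [uIoc_of_le hh.le] at hs
    have h2 : (t + h - s) ^ (γ - 1) ≤ t ^ (γ - 1) :=
      Real.rpow_le_rpow_of_nonpos ht (by linarith [hs.2]) (by linarith)
    have h3 : 0 ≤ (t + h - s) ^ (γ - 1) := Real.rpow_nonneg (by linarith [hs.2]) _
    have h4 := hF s ⟨hs.1.le, hs.2⟩
    rw [norm_mul, Real.norm_eq_abs, Real.norm_eq_abs, abs_of_nonneg h3, mul_comm]
    have := (abs_nonneg (F s)).trans h4
    gcongr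
  rw [sub_zero, abs_of_pos hh, Real.norm_eq_abs] at h1
  rw [GQ, abs_mul, abs_of_pos (inv_pos.2 hh), inv_mul_le_iff₀ hh]
  linarith

lemma rpow_diff (γ t x h : ℝ) (hγ : 0 < γ) (hγ1 : γ ≤ 1) (ht : 0 < t) (hh : 0 < h)
    (hx : t ≤ x) (hxh : x ≤ t + h) :
    |x ^ (γ - 1) - t ^ (γ - 1)| ≤ h ^ (γ / 2) * t ^ (γ / 2 - 1) := by
  have hx0 : 0 < x := by linarith
  have h1 : x ^ (γ - 1) ≤ t ^ (γ - 1) := Real.rpow_le_rpow_of_nonpos ht hx (by linarith)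
  rw [abs_of_nonpos (by linarith)]
  have e1 : x ^ (γ - 1) = t ^ (γ - 1) * (t / x) ^ (1 - γ) := by
    rw [Real.div_rpow ht.le hx0.le, show 1 - γ = -(γ - 1) by ring, Real.rpow_neg ht.le,
      Real.rpow_neg hx0.le]
    have := Real.rpow_pos_of_pos ht (γ - 1)
    have := Real.rpow_pos_of_pos hx0 (γ - 1)
    field_simp
  have h2 : t / x ≤ (t / x) ^ (1 - γ) := by
    have := Real.rpow_le_rpow_of_exponent_ge (x := t / x) (y := 1) (z := 1 - γ)
      (by positivity) (by rw [div_le_one hx0]; exact hx) (by linarith)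
    rwa [Real.rpow_one] at this
  have h3 : 1 - t / x ≤ (h / t) ^ (γ / 2) := by
    rcases le_total t h with hc | hc
    · have : 1 ≤ (h / t) ^ (γ / 2) :=
        Real.one_le_rpow (by rw [one_le_div ht]; exact hc) (by linarith)
      have : 0 < t / x := by positivity
      linarith
    · have h4 : h / t ≤ (h / t) ^ (γ / 2) := by
        have := Real.rpow_le_rpow_of_exponent_ge (x := h / t) (y := 1) (z := γ / 2)
          (by positivity) (by rw [div_le_one ht]; exact hc) (by linarith)
        rwa [Real.rpow_one] at this
      have h5 : 1 - t / x ≤ h / t := by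
        rw [show 1 - t / x = (x - t) / x by field_simp]
        apply div_le_div₀ hh.le (by linarith) ht hx
      linarith
  have e2 : h ^ (γ / 2) * t ^ (γ / 2 - 1) = t ^ (γ - 1) * (h / t) ^ (γ / 2) := by
    rw [Real.div_rpow hh.le ht.le, show γ / 2 - 1 = (γ - 1) + -(γ / 2) by ring,
      Real.rpow_add ht, Real.rpow_neg ht.le]
    ring
  rw [e2, e1]
  have := Real.rpow_pos_of_pos ht (γ - 1)
  nlinarith

lemma GQ_lim (γ Fm ω : ℝ) (hγ : 0 < γ) (hγ1 : γ ≤ 1) (F : ℝ → ℝ) (hFc : Continuous F)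
    (h t : ℝ) (hh : 0 < h) (ht : 0 < t)
    (hF : ∀ s ∈ Icc 0 h, |F s| ≤ Fm) (hω : ∀ s ∈ Icc 0 h, |F s - F 0| ≤ ω) :
    |GQ γ F h t - F 0 * t ^ (γ - 1)| ≤
      ω * t ^ (γ - 1) + Fm * (h ^ (γ / 2) * t ^ (γ / 2 - 1)) := by
  have e : GQ γ F h t - F 0 * t ^ (γ - 1) =
      h⁻¹ * ∫ s in (0:ℝ)..h, ((t + h - s) ^ (γ - 1) * F s - F 0 * t ^ (γ - 1)) := by
    rw [intervalIntegral.integral_sub ((kerI γ hγ (t + h) _ _).mul_continuousOn (by fun_prop))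
      (by simp), intervalIntegral.integral_const, GQ, smul_eq_mul]
    field_simp
    ring
  rw [e, abs_mul, abs_of_pos (inv_pos.2 hh), inv_mul_le_iff₀ hh]
  have h1 : ‖∫ s in (0:ℝ)..h, ((t + h - s) ^ (γ - 1) * F s - F 0 * t ^ (γ - 1))‖ ≤
      (ω * t ^ (γ - 1) + Fm * (h ^ (γ / 2) * t ^ (γ / 2 - 1))) * |h - 0| := by
    apply intervalIntegral.norm_integral_le_of_norm_le_const
    intro s hs
    rw [uIoc_of_le hh.le] at hs
    have h2 := rpow_diff γ t (t + h - s) h hγ hγ1 ht hh (by linarith [hs.2]) (by linarith [hs.1])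
    have h4 := hF s ⟨hs.1.le, hs.2⟩
    have h5 := hω s ⟨hs.1.le, hs.2⟩
    have h6 : (t + h - s) ^ (γ - 1) * F s - F 0 * t ^ (γ - 1) =
      (F s - F 0) * t ^ (γ - 1) + F s * ((t + h - s) ^ (γ - 1) - t ^ (γ - 1)) := by ring
    rw [h6, Real.norm_eq_abs]
    refine (abs_add_le _ _).trans ?_
    rw [abs_mul, abs_mul, abs_of_pos (Real.rpow_pos_of_pos ht _)]
    have := (abs_nonneg (F s)).trans h4
    gcongr
  rw [sub_zero, abs_of_pos hh, Real.norm_eq_abs] at h1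
  linarith

lemma ev_Icc (P : ℝ → Prop) (hP : ∀ᶠ s in 𝓝 (0:ℝ), P s) :
    ∀ᶠ h in 𝓝[>] (0:ℝ), ∀ s ∈ Icc 0 h, P s := by
  obtain ⟨δ, hδ, hb⟩ := Metric.eventually_nhds_iff.1 hP
  filter_upwards [Ioo_mem_nhdsGT hδ] with h hh s hs
  apply hb
  rw [Real.dist_eq, sub_zero, abs_of_nonneg hs.1]
  exact hs.2.trans_lt hh.2

lemma GQ_ev_bound (γ : ℝ) (hγ1 : γ ≤ 1) (F : ℝ → ℝ) (hFc : Continuous F) :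
    ∀ᶠ h in 𝓝[>] (0:ℝ), ∀ t, 0 < t → |GQ γ F h t| ≤ (|F 0| + 1) * t ^ (γ - 1) := by
  have h1 : ∀ᶠ s in 𝓝 (0:ℝ), |F s| ≤ |F 0| + 1 :=
    (hFc.abs.tendsto 0).eventually_le_const (by linarith)
  filter_upwards [ev_Icc _ h1, self_mem_nhdsWithin] with h hh hpos t ht
  exact GQ_bound γ _ hγ1 F h t hpos ht hh

lemma GQ_ev_lim (γ : ℝ) (hγ : 0 < γ) (hγ1 : γ ≤ 1) (F : ℝ → ℝ) (hFc : Continuous F)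
    (ω : ℝ) (hω : 0 < ω) :
    ∀ᶠ h in 𝓝[>] (0:ℝ), ∀ t, 0 < t → |GQ γ F h t - F 0 * t ^ (γ - 1)| ≤
      ω * (t ^ (γ - 1) + t ^ (γ / 2 - 1)) := by
  have h1 : ∀ᶠ s in 𝓝 (0:ℝ), |F s| ≤ |F 0| + 1 :=
    (hFc.abs.tendsto 0).eventually_le_const (by linarith)
  have h2 : ∀ᶠ s in 𝓝 (0:ℝ), |F s - F 0| ≤ ω := by
    have : Continuous fun s => |F s - F 0| := by fun_prop
    exact (this.tendsto 0).eventually_le_const (by simpa using hω)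
  have h3 : ∀ᶠ h in 𝓝[>] (0:ℝ), (|F 0| + 1) * h ^ (γ / 2) ≤ ω := by
    have : Continuous fun h : ℝ => (|F 0| + 1) * h ^ (γ / 2) :=
      continuous_const.mul (Real.continuous_rpow_const (by linarith))
    apply ((this.tendsto 0).mono_left nhdsWithin_le_nhds).eventually_le_const
    rw [Real.zero_rpow (by linarith)]
    simpa using hω
  filter_upwards [ev_Icc _ h1, ev_Icc _ h2, h3, self_mem_nhdsWithin] with h hh hh2 hh3 hpos t ht
  have := GQ_lim γ _ ω hγ hγ1 F hFc h t hpos ht hh hh2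
  have hp := Real.rpow_pos_of_pos ht (γ / 2 - 1)
  nlinarith [mul_le_mul_of_nonneg_right hh3 hp.le]

lemma vol_abs (γ μ C E t : ℝ) (hγ : 0 < γ) (hμ : 0 < μ) (ht : 0 < t) (φ ψ : ℝ → ℝ)
    (hψ : Continuous ψ)
    (h : ∀ s ∈ Ioc 0 t, |φ s| ≤ C * |ψ s| + E * s ^ (μ - 1)) :
    |∫ s in (0:ℝ)..t, (t - s) ^ (γ - 1) * φ s| ≤
      C * (∫ s in (0:ℝ)..t, (t - s) ^ (γ - 1) * |ψ s|) + E * (Bc γ μ * t ^ (γ + μ - 1)) := by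
  have I1 : IntervalIntegrable (fun s => C * ((t - s) ^ (γ - 1) * |ψ s|)) volume 0 t :=
    ((kerI γ hγ t _ _).mul_continuousOn (by fun_prop)).const_mul C
  have I2 : IntervalIntegrable (fun s => E * ((t - s) ^ (γ - 1) * s ^ (μ - 1))) volume 0 t :=
    (betaI γ μ hγ hμ t ht).const_mul E
  rw [← beta_scaled γ μ t ht, ← intervalIntegral.integral_const_mul,
    ← intervalIntegral.integral_const_mul, ← intervalIntegral.integral_add I1 I2,
    ← Real.norm_eq_abs]
  apply intervalIntegral.norm_integral_le_of_norm_le ht.le _ (I1.add I2)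
  filter_upwards with s hs
  have h3 : 0 ≤ (t - s) ^ (γ - 1) := Real.rpow_nonneg (by linarith [hs.2]) _
  rw [norm_mul, Real.norm_eq_abs, Real.norm_eq_abs, abs_of_nonneg h3]
  have := mul_le_mul_of_nonneg_left (h s hs) h3
  linarith

lemma DQ_bdd (γ c T T1 : ℝ) (hγ : 0 < γ) (hγ1 : γ < 1) (hT : 0 < T) (hT1 : T < T1)
    (u F a : ℝ → ℝ) (huc : Continuous u) (hF : Continuous F) (ha : Continuous a)
    (heq : ∀ t ∈ Icc 0 T1, u t = c + (1 / Real.Gamma γ) *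
      ∫ s in (0:ℝ)..t, (t - s) ^ (γ - 1) * F s)
    (H : ∀ ε > 0, ∀ᶠ h in 𝓝[>] (0:ℝ), ∀ s ∈ Icc 0 T,
      |DQ F h s - a s * DQ u h s| ≤ ε * |DQ u h s|) :
    ∃ M > 0, ∀ᶠ h in 𝓝[>] (0:ℝ), ∀ t ∈ Ioc 0 T,
      |DQ u h t| ≤ M * t ^ (γ - 1) ∧ |DQ F h t| ≤ M * t ^ (γ - 1) := by
  obtain ⟨A, hA⟩ := isCompact_Icc.exists_bound_of_continuousOn (s := Icc 0 T) ha.continuousOn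
  have hA0 : 0 ≤ A := (norm_nonneg _).trans (hA 0 ⟨le_rfl, hT.le⟩)
  have hΓ : 0 < 1 / Real.Gamma γ := by
    have := Real.Gamma_pos_of_pos hγ
    positivity
  set g := 1 / Real.Gamma γ with hg
  obtain ⟨M, hM, hgr⟩ := gronwall γ γ (g * (A + 1)) T hγ hγ1.le hγ hγ1 (by positivity) hT
  set M1 := M * (g * (|F 0| + 1)) with hM1
  have hM1p : 0 < M1 := by positivity
  refine ⟨(A + 1) * M1, by positivity, ?_⟩
  filter_upwards [H 1 one_pos, GQ_ev_bound γ hγ1.le F hF,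
    Ioo_mem_nhdsGT (sub_pos.2 hT1)] with h hH hG hh
  have hN : ∀ s ∈ Icc 0 T, |DQ F h s| ≤ (A + 1) * |DQ u h s| := by
    intro s hs
    have h1 := hH s hs
    have h2 := hA s hs
    rw [Real.norm_eq_abs] at h2
    have h3 : |DQ F h s| ≤ |DQ F h s - a s * DQ u h s| + |a s * DQ u h s| := by
      simpa using abs_add_le (DQ F h s - a s * DQ u h s) (a s * DQ u h s)
    rw [abs_mul] at h3
    have := mul_le_mul_of_nonneg_right h2 (abs_nonneg (DQ u h s))
    linarith
  have hD : ∀ t ∈ Ioc 0 T, |DQ u h t| ≤ M1 * t ^ (γ - 1) := by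
    have := hgr (DQ u h) (DQ_cont u huc h) (g * (|F 0| + 1)) (by positivity) ?_
    · exact fun t ht => (this t ht).trans (le_of_eq (by rw [hM1]))
    intro t ht
    rw [DQ_eq γ c T1 hγ u F hF heq h t hh.1 ht.1.le (by linarith [hh.2, ht.2])]
    refine (abs_add_le _ _).trans ?_
    rw [abs_mul, abs_mul, abs_of_pos hΓ]
    have h1 := vol_abs γ 1 (A + 1) 0 t hγ one_pos ht.1 (DQ F h) (DQ u h) (DQ_cont u huc h)
      (by
        intro s hs
        have := hN s ⟨hs.1.le, hs.2.trans ht.2⟩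
        linarith)
    have h2 := mul_le_mul_of_nonneg_left h1 hΓ.le
    have h3 := mul_le_mul_of_nonneg_left (hG t ht.1) hΓ.le
    linarith
  intro t ht
  have hp := Real.rpow_pos_of_pos ht.1 (γ - 1)
  have h1 := hD t ht
  have h2 := hN t ⟨ht.1.le, ht.2⟩
  constructor
  · have : M1 * t ^ (γ - 1) ≤ (A + 1) * (M1 * t ^ (γ - 1)) := by
      apply le_mul_of_one_le_left (by positivity)
      linarith
    linarith
  · have := mul_le_mul_of_nonneg_left h1 (by linarith : 0 ≤ A + 1)
    linarith

lemma DQ_cauchy (γ c T T1 : ℝ) (hγ : 0 < γ) (hγ1 : γ < 1) (hT : 0 < T) (hT1 : T < T1)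
    (u F a : ℝ → ℝ) (huc : Continuous u) (hF : Continuous F) (ha : Continuous a)
    (heq : ∀ t ∈ Icc 0 T1, u t = c + (1 / Real.Gamma γ) *
      ∫ s in (0:ℝ)..t, (t - s) ^ (γ - 1) * F s)
    (H : ∀ ε > 0, ∀ᶠ h in 𝓝[>] (0:ℝ), ∀ s ∈ Icc 0 T,
      |DQ F h s - a s * DQ u h s| ≤ ε * |DQ u h s|) (ε : ℝ) (hε : 0 < ε) :
    ∀ᶠ p in (𝓝[>] (0:ℝ)) ×ˢ (𝓝[>] (0:ℝ)), ∀ t ∈ Ioc 0 T,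
      |DQ u p.1 t - DQ u p.2 t| ≤ ε * t ^ (γ / 2 - 1) := by
  obtain ⟨A, hA⟩ := isCompact_Icc.exists_bound_of_continuousOn (s := Icc 0 T) ha.continuousOn
  have hA0 : 0 ≤ A := (norm_nonneg _).trans (hA 0 ⟨le_rfl, hT.le⟩)
  have hΓ : 0 < 1 / Real.Gamma γ := by
    have := Real.Gamma_pos_of_pos hγ
    positivity
  obtain ⟨M, hM, hbd⟩ := DQ_bdd γ c T T1 hγ hγ1 hT hT1 u F a huc hF ha heq H
  set g := 1 / Real.Gamma γ with hg
  obtain ⟨M2, hM2, hgr⟩ := gronwall γ (γ / 2) (g * A) T hγ hγ1.le (by linarith) (by linarith)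
    (by positivity) hT
  set P := T ^ (γ / 2) with hP
  set Q := T ^ (3 * γ / 2) with hQ
  have hB := Bc_nonneg γ γ
  have hPp : 0 < P := by positivity
  have hQp : 0 < Q := by positivity
  set K := 2 * g * (P + 1) + 2 * g * M * Bc γ γ * Q with hK
  have hKp : 0 < K := by positivity
  set ω := ε / (M2 * K) with hω
  have hωp : 0 < ω := by positivity
  have hωK : M2 * (ω * K) = ε := by
    rw [hω]
    field_simp
  let R : ℝ → Prop := fun h => (0 < h ∧ h < T1 - T) ∧
    (∀ t ∈ Ioc 0 T, |DQ u h t| ≤ M * t ^ (γ - 1)) ∧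
    (∀ s ∈ Icc 0 T, |DQ F h s - a s * DQ u h s| ≤ ω * |DQ u h s|) ∧
    (∀ t, 0 < t → |GQ γ F h t - F 0 * t ^ (γ - 1)| ≤ ω * (t ^ (γ - 1) + t ^ (γ / 2 - 1)))
  have hR : ∀ᶠ h in 𝓝[>] (0:ℝ), R h := by
    filter_upwards [hbd, H ω hωp, GQ_ev_lim γ hγ hγ1.le F hF ω hωp,
      Ioo_mem_nhdsGT (sub_pos.2 hT1)] with h h1 h2 h3 h4
    exact ⟨h4, fun t ht => (h1 t ht).1, h2, h3⟩
  filter_upwards [hR.prod_mk hR]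
  rintro ⟨h, k⟩ ⟨⟨hh, hbh, hHh, hGh⟩, ⟨hk, hbk, hHk, hGk⟩⟩
  simp only at *
  have key := hgr (fun t => DQ u h t - DQ u k t)
    ((DQ_cont u huc h).sub (DQ_cont u huc k)) (ω * K) (by positivity) ?_
  · intro t ht
    rw [← hωK]
    exact key t ht
  intro t ht
  have ht0 := ht.1
  have I : ∀ h, IntervalIntegrable (fun s => (t - s) ^ (γ - 1) * DQ F h s) volume 0 t :=
    fun h => (kerI γ hγ t _ _).mul_continuousOn (DQ_cont F hF h).continuousOn
  have e : DQ u h t - DQ u k t = g * (GQ γ F h t - F 0 * t ^ (γ - 1)) +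
      (-(g * (GQ γ F k t - F 0 * t ^ (γ - 1))) +
      g * ∫ s in (0:ℝ)..t, (t - s) ^ (γ - 1) * (DQ F h s - DQ F k s)) := by
    rw [DQ_eq γ c T1 hγ u F hF heq h t hh.1 ht.1.le (by linarith [hh.2, ht.2]),
      DQ_eq γ c T1 hγ u F hF heq k t hk.1 ht.1.le (by linarith [hk.2, ht.2])]
    have : ∫ s in (0:ℝ)..t, (t - s) ^ (γ - 1) * (DQ F h s - DQ F k s) =
      (∫ s in (0:ℝ)..t, (t - s) ^ (γ - 1) * DQ F h s) -
        ∫ s in (0:ℝ)..t, (t - s) ^ (γ - 1) * DQ F k s := by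
      rw [← intervalIntegral.integral_sub (I h) (I k)]
      congr 1
      ext s
      ring
    rw [this]
    ring
  have hv := vol_abs γ γ A (2 * ω * M) t hγ hγ ht0 (fun s => DQ F h s - DQ F k s)
    (fun s => DQ u h s - DQ u k s) ((DQ_cont u huc h).sub (DQ_cont u huc k)) (by
      intro s hs
      have hs1 : s ∈ Ioc 0 T := ⟨hs.1, hs.2.trans ht.2⟩
      have hs2 : s ∈ Icc 0 T := ⟨hs.1.le, hs.2.trans ht.2⟩
      have h1 := (hHh s hs2).trans (mul_le_mul_of_nonneg_left (hbh s hs1) hωp.le)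
      have h2 := (hHk s hs2).trans (mul_le_mul_of_nonneg_left (hbk s hs1) hωp.le)
      have h3 := hA s hs2
      rw [Real.norm_eq_abs] at h3
      have h4 : DQ F h s - DQ F k s = a s * (DQ u h s - DQ u k s) +
        ((DQ F h s - a s * DQ u h s) - (DQ F k s - a s * DQ u k s)) := by ring
      rw [h4]
      have h5 := abs_add_le (a s * (DQ u h s - DQ u k s))
        ((DQ F h s - a s * DQ u h s) - (DQ F k s - a s * DQ u k s))
      have h6 := abs_sub (DQ F h s - a s * DQ u h s) (DQ F k s - a s * DQ u k s)
      rw [abs_mul] at h5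
      have h7 := mul_le_mul_of_nonneg_right h3 (abs_nonneg (DQ u h s - DQ u k s))
      linarith)
  set W := t ^ (γ / 2 - 1) with hW
  have hWp : 0 < W := by positivity
  have p1 : t ^ (γ - 1) ≤ P * W := by
    rw [show γ - 1 = γ / 2 + (γ / 2 - 1) by ring, Real.rpow_add ht0]
    apply mul_le_mul_of_nonneg_right _ hWp.le
    exact Real.rpow_le_rpow ht0.le ht.2 (by linarith)
  have p2 : t ^ (γ + γ - 1) ≤ Q * W := by
    rw [show γ + γ - 1 = 3 * γ / 2 + (γ / 2 - 1) by ring, Real.rpow_add ht0]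
    apply mul_le_mul_of_nonneg_right _ hWp.le
    exact Real.rpow_le_rpow ht0.le ht.2 (by linarith)
  rw [e]
  have h1 := abs_add_le (g * (GQ γ F h t - F 0 * t ^ (γ - 1)))
    (-(g * (GQ γ F k t - F 0 * t ^ (γ - 1))) +
      g * ∫ s in (0:ℝ)..t, (t - s) ^ (γ - 1) * (DQ F h s - DQ F k s))
  have h2 := abs_add_le (-(g * (GQ γ F k t - F 0 * t ^ (γ - 1))))
      (g * ∫ s in (0:ℝ)..t, (t - s) ^ (γ - 1) * (DQ F h s - DQ F k s))
  rw [abs_mul, abs_of_pos hΓ] at h1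
  rw [abs_neg, abs_mul, abs_mul, abs_of_pos hΓ] at h2
  have q : ω * (t ^ (γ - 1) + W) ≤ ω * ((P + 1) * W) := by
    apply mul_le_mul_of_nonneg_left _ hωp.le
    linarith
  have h3 := mul_le_mul_of_nonneg_left ((hGh t ht0).trans q) hΓ.le
  have h4 := mul_le_mul_of_nonneg_left ((hGk t ht0).trans q) hΓ.le
  have h5 : 2 * ω * M * (Bc γ γ * t ^ (γ + γ - 1)) ≤ 2 * ω * M * (Bc γ γ * (Q * W)) := by
    gcongr
  have h6 := mul_le_mul_of_nonneg_left hv hΓ.le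
  have h7 := mul_le_mul_of_nonneg_left h5 hΓ.le
  have h8 : ω * K * W = g * (ω * ((P + 1) * W)) + g * (ω * ((P + 1) * W)) +
    g * (2 * ω * M * (Bc γ γ * (Q * W))) := by
    rw [hK]; ring
  rw [h8]
  linarith

lemma core (γ c T T1 : ℝ) (hγ : 0 < γ) (hγ1 : γ < 1) (hT : 0 < T) (hT1 : T < T1)
    (u F a : ℝ → ℝ) (huc : Continuous u) (hF : Continuous F) (ha : Continuous a)
    (heq : ∀ t ∈ Icc 0 T1, u t = c + (1 / Real.Gamma γ) *
      ∫ s in (0:ℝ)..t, (t - s) ^ (γ - 1) * F s)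
    (H : ∀ ε > 0, ∀ᶠ h in 𝓝[>] (0:ℝ), ∀ s ∈ Icc 0 T,
      |DQ F h s - a s * DQ u h s| ≤ ε * |DQ u h s|) :
    ∃ y : ℝ → ℝ, ∃ M > 0, (∀ t ∈ Ioo 0 T, HasDerivAt u (y t) t) ∧
      (∀ t ∈ Ioo 0 T, ContinuousAt y t) ∧
      (∀ t ∈ Ioo 0 T, |y t| ≤ M * t ^ (γ - 1)) ∧
      (∀ t ∈ Ioo 0 T, y t = (1 / Real.Gamma γ) * (F 0 * t ^ (γ - 1)) +
        (1 / Real.Gamma γ) * ∫ s in (0:ℝ)..t, (t - s) ^ (γ - 1) * (a s * y s)) := by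
  obtain ⟨M, hM, hbd⟩ := DQ_bdd γ c T T1 hγ hγ1 hT hT1 u F a huc hF ha heq H
  have hC := DQ_cauchy γ c T T1 hγ hγ1 hT hT1 u F a huc hF ha heq H
  have hlim : ∀ t : ℝ, ∃ l : ℝ, t ∈ Ioc 0 T → Tendsto (fun h => DQ u h t) (𝓝[>] 0) (𝓝 l) := by
    intro t
    by_cases ht : t ∈ Ioc 0 T
    · have : Cauchy (map (fun h => DQ u h t) (𝓝[>] (0:ℝ))) := by
        rw [cauchy_map_iff]
        refine ⟨inferInstance, ?_⟩
        rw [Metric.uniformity_basis_dist.tendsto_right_iff]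
        intro ε hε
        have hp := Real.rpow_pos_of_pos ht.1 (γ / 2 - 1)
        filter_upwards [hC (ε / 2 / t ^ (γ / 2 - 1)) (by positivity)] with p hp1
        have := hp1 t ht
        rw [div_mul_cancel₀ _ hp.ne'] at this
        simp only [Real.dist_eq]
        linarith
      obtain ⟨l, hl⟩ := CompleteSpace.complete this
      exact ⟨l, fun _ => hl⟩
    · exact ⟨0, fun h => absurd h ht⟩
  choose y hy using hlim
  have hunif : ∀ ε > 0, ∀ᶠ h in 𝓝[>] (0:ℝ), ∀ t ∈ Ioc 0 T,
      |DQ u h t - y t| ≤ ε * t ^ (γ / 2 - 1) := by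
    intro ε hε
    filter_upwards [(hC ε hε).curry] with h hh t ht
    have h1 : Tendsto (fun k => |DQ u h t - DQ u k t|) (𝓝[>] 0) (𝓝 |DQ u h t - y t|) :=
      ((hy t ht).const_sub _).abs
    apply le_of_tendsto h1
    filter_upwards [hh] with k hk
    exact hk t ht
  have hybd : ∀ t ∈ Ioc 0 T, |y t| ≤ M * t ^ (γ - 1) := by
    intro t ht
    apply le_of_tendsto (hy t ht).abs
    filter_upwards [hbd] with h hh
    exact (hh t ht).1
  have hyc : ∀ t ∈ Ioo 0 T, ContinuousAt y t := by
    intro t ht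
    have ht2 : 0 < t / 2 := by linarith [ht.1]
    have h1 : TendstoUniformlyOn (fun h => DQ u h) y (𝓝[>] 0) (Ioo (t / 2) T) := by
      rw [Metric.tendstoUniformlyOn_iff]
      intro ε hε
      have hp := Real.rpow_pos_of_pos ht2 (γ / 2 - 1)
      filter_upwards [hunif (ε / 2 / (t / 2) ^ (γ / 2 - 1)) (by positivity)] with h hh x hx
      have h2 := hh x ⟨by linarith [hx.1], hx.2.le⟩
      have h3 : x ^ (γ / 2 - 1) ≤ (t / 2) ^ (γ / 2 - 1) :=
        Real.rpow_le_rpow_of_nonpos ht2 hx.1.le (by linarith)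
      have h4 : ε / 2 / (t / 2) ^ (γ / 2 - 1) * x ^ (γ / 2 - 1) ≤
          ε / 2 / (t / 2) ^ (γ / 2 - 1) * (t / 2) ^ (γ / 2 - 1) :=
        mul_le_mul_of_nonneg_left h3 (by positivity)
      rw [div_mul_cancel₀ _ hp.ne'] at h4
      rw [dist_comm, Real.dist_eq]
      linarith
    have h2 : ContinuousOn y (Ioo (t / 2) T) :=
      h1.continuousOn (Eventually.of_forall fun h => (DQ_cont u huc h).continuousOn).frequently
    exact h2.continuousAt (Ioo_mem_nhds (by linarith [ht.1]) ht.2)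
  have hright : ∀ t ∈ Ioo 0 T, HasDerivWithinAt u (y t) (Ici t) t := by
    intro t ht
    rw [← hasDerivWithinAt_Ioi_iff_Ici, hasDerivWithinAt_iff_tendsto_slope' (by simp)]
    have h1 : Tendsto (fun x : ℝ => x - t) (𝓝[>] t) (𝓝[>] 0) := by
      apply tendsto_nhdsWithin_of_tendsto_nhds_of_eventually_within
      · have : Continuous fun x : ℝ => x - t := by fun_prop
        simpa using (this.tendsto t).mono_left nhdsWithin_le_nhds
      · filter_upwards [self_mem_nhdsWithin] with x hx
        exact sub_pos.2 (mem_Ioi.1 hx)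
    have h2 := (hy t ⟨ht.1, ht.2.le⟩).comp h1
    refine h2.congr fun x => ?_
    simp only [Function.comp, DQ, slope_def_field]
    congr 3
    ring
  refine ⟨y, M, hM, ?_, hyc, fun t ht => hybd t ⟨ht.1, ht.2.le⟩, ?_⟩
  · intro t ht
    set p := t / 2 with hp
    set q := (t + T) / 2 with hq
    have hp0 : 0 < p := by linarith [ht.1]
    have hpt : p < t := by linarith [ht.1]
    have htq : t < q := by linarith [ht.2]
    have hqT : q < T := by linarith [ht.2]
    have hyI : ContinuousOn y (Icc p q) := fun x hx =>
      (hyc x ⟨by linarith [hx.1], by linarith [hx.2]⟩).continuousWithinAt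
    have hder : ∀ x ∈ Icc p q, HasDerivAt (fun x => u p + ∫ s in p..x, y s) (y x) x := by
      intro x hx
      apply HasDerivAt.const_add
      apply intervalIntegral.integral_hasDerivAt_right
      · apply ContinuousOn.intervalIntegrable
        rw [uIcc_of_le hx.1]
        exact hyI.mono (Icc_subset_Icc le_rfl hx.2)
      · apply ContinuousAt.stronglyMeasurableAtFilter (s := Ioo 0 T) isOpen_Ioo hyc
        exact ⟨by linarith [hx.1], by linarith [hx.2]⟩
      · exact hyc x ⟨by linarith [hx.1], by linarith [hx.2]⟩
    have heq2 := eq_of_has_deriv_right_eq (f := u) (g := fun x => u p + ∫ s in p..x, y s)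
      (a := p) (b := q) (f' := y)
      (fun x hx => hright x ⟨by linarith [hx.1], by linarith [hx.2]⟩)
      (fun x hx => (hder x ⟨hx.1, hx.2.le⟩).hasDerivWithinAt) huc.continuousOn
      (fun x hx => (hder x hx).continuousAt.continuousWithinAt) (by simp)
    apply (hder t ⟨hpt.le, htq.le⟩).congr_of_eventuallyEq
    filter_upwards [Icc_mem_nhds hpt htq] with x hx
    exact heq2 x hx
  · intro t ht
    have ht' : t ∈ Ioc 0 T := ⟨ht.1, ht.2.le⟩
    have L1 : Tendsto (fun h => GQ γ F h t) (𝓝[>] 0) (𝓝 (F 0 * t ^ (γ - 1))) := by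
      rw [Metric.tendsto_nhds]
      intro ε hε
      have p1 := Real.rpow_pos_of_pos ht.1 (γ - 1)
      have p2 := Real.rpow_pos_of_pos ht.1 (γ / 2 - 1)
      filter_upwards [GQ_ev_lim γ hγ hγ1.le F hF (ε / 2 / (t ^ (γ - 1) + t ^ (γ / 2 - 1)))
        (by positivity)] with h hh
      have := hh t ht.1
      rw [div_mul_cancel₀ _ (by positivity)] at this
      rw [Real.dist_eq]
      linarith
    have L2 : Tendsto (fun h => ∫ s in (0:ℝ)..t, (t - s) ^ (γ - 1) * DQ F h s) (𝓝[>] 0)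
        (𝓝 (∫ s in (0:ℝ)..t, (t - s) ^ (γ - 1) * (a s * y s))) := by
      apply intervalIntegral.tendsto_integral_filter_of_dominated_convergence
        (fun s => M * ((t - s) ^ (γ - 1) * s ^ (γ - 1)))
      · refine Eventually.of_forall fun h => ?_
        have := (kerI γ hγ t 0 t).mul_continuousOn (DQ_cont F hF h).continuousOn
        rw [intervalIntegrable_iff] at this
        exact this.aestronglyMeasurable
      · filter_upwards [hbd] with h hh
        filter_upwards with s hs
        rw [uIoc_of_le ht.1.le] at hs
        have h3 : 0 ≤ (t - s) ^ (γ - 1) := Real.rpow_nonneg (by linarith [hs.2]) _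
        rw [norm_mul, Real.norm_eq_abs, Real.norm_eq_abs, abs_of_nonneg h3]
        have := mul_le_mul_of_nonneg_left (hh s ⟨hs.1, hs.2.trans ht.2.le⟩).2 h3
        linarith
      · exact (betaI γ γ hγ hγ t ht.1).const_mul M
      · filter_upwards with s hs
        rw [uIoc_of_le ht.1.le] at hs
        apply Tendsto.const_mul
        have hs1 : s ∈ Ioc 0 T := ⟨hs.1, hs.2.trans ht.2.le⟩
        have k1 : Tendsto (fun h => DQ F h s - a s * DQ u h s) (𝓝[>] 0) (𝓝 0) := by
          rw [Metric.tendsto_nhds]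
          intro ε hε
          have p1 := Real.rpow_pos_of_pos hs.1 (γ - 1)
          filter_upwards [hbd, H (ε / 2 / (M * s ^ (γ - 1))) (by positivity)] with h h1 h2
          have h3 := h2 s ⟨hs1.1.le, hs1.2⟩
          have h4 := mul_le_mul_of_nonneg_left (h1 s hs1).1
            (by positivity : 0 ≤ ε / 2 / (M * s ^ (γ - 1)))
          rw [div_mul_cancel₀ _ (by positivity)] at h4
          rw [Real.dist_eq, sub_zero]
          linarith
        have k2 := k1.add ((hy s hs1).const_mul (a s))
        simpa using k2
    have L3 := (L1.const_mul (1 / Real.Gamma γ)).add (L2.const_mul (1 / Real.Gamma γ))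
    apply tendsto_nhds_unique (hy t ht')
    refine L3.congr' ?_
    filter_upwards [Ioo_mem_nhdsGT (sub_pos.2 hT1)] with h hh
    exact (DQ_eq γ c T1 hγ u F hF heq h t hh.1 ht.1.le (by linarith [hh.2, ht.2])).symm

/-- Verification of the hypothesis `H` of `core` for a composition. -/
lemma comp_H (T : ℝ) (u f f' : ℝ → ℝ) (huc : UniformContinuous u) (m M : ℝ)
    (hu : ∀ t, u t ∈ Icc m M)
    (hd : ∀ x ∈ Icc m M, HasDerivAt f (f' x) x) (hc : ContinuousOn f' (Icc m M)) :
    ∀ ε > 0, ∀ᶠ h in 𝓝[>] (0:ℝ), ∀ s ∈ Icc 0 T,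
      |DQ (fun t => f (u t)) h s - f' (u s) * DQ u h s| ≤ ε * |DQ u h s| := by
  intro ε hε
  have hcu := isCompact_Icc.uniformContinuousOn_of_continuous hc
  rw [Metric.uniformContinuousOn_iff] at hcu
  obtain ⟨δ, hδ, hδ1⟩ := hcu ε hε
  rw [Metric.uniformContinuous_iff] at huc
  obtain ⟨η, hη, hη1⟩ := huc δ hδ
  filter_upwards [Ioo_mem_nhdsGT hη] with h hh s hs
  have h1 : dist (u (s + h)) (u s) < δ := hη1 (by
    rw [Real.dist_eq]
    simp only [add_sub_cancel_left, abs_of_pos hh.1]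
    exact hh.2)
  rw [Real.dist_eq] at h1
  have hsub : uIcc (u s) (u (s + h)) ⊆ Icc m M := uIcc_subset_Icc (hu s) (hu (s + h))
  have key := (convex_uIcc (u s) (u (s + h))).norm_image_sub_le_of_norm_hasDerivWithin_le
    (𝕜 := ℝ) (f := fun x => f x - f' (u s) * x) (f' := fun x => f' x - f' (u s) * 1) (C := ε)
    (x := u s) (y := u (s + h))
    (fun x hx => ((hd x (hsub hx)).sub ((hasDerivAt_id x).const_mul _)).hasDerivWithinAt)
    (by
      intro x hx
      have h2 : |x - u s| < δ := (abs_sub_left_of_mem_uIcc hx).trans_lt h1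
      have := hδ1 x (hsub hx) (u s) (hu s) (by rwa [Real.dist_eq])
      rw [Real.dist_eq] at this
      rw [mul_one, Real.norm_eq_abs]
      exact this.le)
    left_mem_uIcc right_mem_uIcc
  rw [Real.norm_eq_abs, Real.norm_eq_abs] at key
  have e : DQ (fun t => f (u t)) h s - f' (u s) * DQ u h s =
      (f (u (s + h)) - f' (u s) * u (s + h) - (f (u s) - f' (u s) * u s)) / h := by
    simp only [DQ]
    ring
  rw [e, DQ, abs_div, abs_div, ← mul_div_assoc]
  have := abs_nonneg h
  gcongr

lemma local_sol (γ α β u₀ T T1 : ℝ) (f f' u : ℝ → ℝ) (hγ : 0 < γ) (hγ1 : γ < 1)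
    (hT : 0 < T) (hT1 : T < T1)
    (hd : ∀ x ∈ Ioo α β, HasDerivAt f (f' x) x) (hc : ContinuousOn f' (Ioo α β))
    (hu0 : u 0 = u₀) (huc : ContinuousOn u (Icc 0 T1)) (hum : ∀ t ∈ Icc 0 T1, u t ∈ Ioo α β)
    (heq : ∀ t ∈ Icc 0 T1, u t = u₀ + (1 / Real.Gamma γ) *
      ∫ s in (0:ℝ)..t, (t - s) ^ (γ - 1) * f (u s)) :
    ∃ y : ℝ → ℝ, ∃ M, ∃ C, (∀ t ∈ Ioo 0 T, HasDerivAt u (y t) t) ∧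
      (∀ t ∈ Ioo 0 T, ContinuousAt y t) ∧
      (∀ t ∈ Ioo 0 T, |y t| ≤ M * t ^ (γ - 1)) ∧
      (∀ t ∈ Ioo 0 T, y t = (f u₀ / Real.Gamma γ) * t ^ (γ - 1) +
        (1 / Real.Gamma γ) * ∫ s in (0:ℝ)..t, (t - s) ^ (γ - 1) * (f' (u s) * y s)) ∧
      (∀ t ∈ Ioo 0 T, |y t - (f u₀ / Real.Gamma γ) * t ^ (γ - 1)| ≤ C * t ^ (γ + γ - 1)) := by
  have h01 : (0:ℝ) ≤ T1 := by linarith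
  obtain ⟨p, hp, hpm⟩ := isCompact_Icc.exists_isMinOn ⟨0, left_mem_Icc.2 h01⟩ huc
  obtain ⟨q, hq, hqm⟩ := isCompact_Icc.exists_isMaxOn ⟨0, left_mem_Icc.2 h01⟩ huc
  have hsub : Icc (u p) (u q) ⊆ Ioo α β := fun x hx =>
    ⟨(hum p hp).1.trans_le hx.1, hx.2.trans_lt (hum q hq).2⟩
  let v : ℝ → ℝ := fun t => u (projIcc 0 T1 h01 t)
  have hvu : ∀ t ∈ Icc 0 T1, v t = u t := by
    intro t ht
    simp only [v, projIcc_of_mem h01 ht]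
  have hvuc : UniformContinuous v := by
    have h1 : UniformContinuous (fun x : Icc (0:ℝ) T1 => u x) :=
      CompactSpace.uniformContinuous_of_continuous (continuousOn_iff_continuous_restrict.1 huc)
    exact h1.comp (LipschitzWith.projIcc h01).uniformContinuous
  have hvm : ∀ t, v t ∈ Icc (u p) (u q) := fun t =>
    ⟨hpm (projIcc 0 T1 h01 t).2, hqm (projIcc 0 T1 h01 t).2⟩
  have hfc : ContinuousOn f (Icc (u p) (u q)) := fun x hx =>
    (hd x (hsub hx)).continuousAt.continuousWithinAt
  have hFc : Continuous (fun t => f (v t)) := hfc.comp_continuous hvuc.continuous hvm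
  have hac : Continuous (fun t => f' (v t)) := (hc.mono hsub).comp_continuous hvuc.continuous hvm
  have hH := comp_H T v f f' hvuc (u p) (u q) hvm (fun x hx => hd x (hsub hx)) (hc.mono hsub)
  obtain ⟨y, M, hM, hy1, hy2, hy3, hy4⟩ := core γ u₀ T T1 hγ hγ1 hT hT1 v (fun t => f (v t))
    (fun t => f' (v t)) hvuc.continuous hFc hac (by
      intro t ht
      rw [hvu t ht, heq t ht]
      congr 2
      apply intervalIntegral.integral_congr
      intro s hs
      rw [uIcc_of_le ht.1] at hs
      simp only
      rw [hvu s ⟨hs.1, hs.2.trans ht.2⟩]) hH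
  have hv0 : v 0 = u₀ := by rw [hvu 0 ⟨le_rfl, h01⟩, hu0]
  have hy4' : ∀ t ∈ Ioo 0 T, y t = (f u₀ / Real.Gamma γ) * t ^ (γ - 1) +
        (1 / Real.Gamma γ) * ∫ s in (0:ℝ)..t, (t - s) ^ (γ - 1) * (f' (u s) * y s) := by
    intro t ht
    rw [hy4 t ht, hv0]
    congr 1
    · ring
    · congr 1
      apply intervalIntegral.integral_congr
      intro s hs
      rw [uIcc_of_le ht.1.le] at hs
      simp only
      rw [hvu s ⟨hs.1, by linarith [hs.2, ht.2]⟩]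
  obtain ⟨A, hA⟩ := isCompact_Icc.exists_bound_of_continuousOn (hc.mono hsub)
  have hΓ : 0 < 1 / Real.Gamma γ := by
    have := Real.Gamma_pos_of_pos hγ
    positivity
  refine ⟨y, M, (1 / Real.Gamma γ) * (A * M * Bc γ γ), ?_, hy2, hy3, hy4', ?_⟩
  · intro t ht
    apply (hy1 t ht).congr_of_eventuallyEq
    filter_upwards [Ioo_mem_nhds ht.1 ht.2] with x hx
    exact (hvu x ⟨hx.1.le, by linarith [hx.2]⟩).symm
  · intro t ht
    have e := hy4' t ht
    have e2 : y t - (f u₀ / Real.Gamma γ) * t ^ (γ - 1) =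
      (1 / Real.Gamma γ) * ∫ s in (0:ℝ)..t, (t - s) ^ (γ - 1) * (f' (u s) * y s) := by
      linarith
    rw [e2, abs_mul, abs_of_pos hΓ]
    have h1 := vol_abs γ γ 0 (A * M) t hγ hγ ht.1 (fun s => f' (u s) * y s) (fun _ => 0)
      continuous_const (by
        intro s hs
        have hs1 : s ∈ Icc 0 T1 := ⟨hs.1.le, by linarith [hs.2, ht.2]⟩
        have h2 := hA (v s) (hvm s)
        rw [hvu s hs1, Real.norm_eq_abs] at h2
        have h3 := hy3 s ⟨hs.1, hs.2.trans_lt ht.2⟩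
        rw [abs_mul]
        have := mul_le_mul h2 h3 (abs_nonneg _) ((abs_nonneg _).trans h2)
        linarith)
    have := mul_le_mul_of_nonneg_left h1 hΓ.le
    linarith

/-- regularity of solutions and the integral equation for `u'`. -/
theorem stmt1 (γ α β u₀ : ℝ) (f f' : ℝ → ℝ) (u : ℝ → ℝ)
    (hγ : γ ∈ Set.Ioo (0:ℝ) 1) (hαβ : α < β)
    (hderiv : ∀ x ∈ Set.Ioo α β, HasDerivAt f (f' x) x)
    (hf' : ∀ x ∈ Set.Ioo α β, ∃ K : NNReal, ∃ s ∈ 𝓝[Set.Ioo α β] x, LipschitzOnWith K f' s)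
    (hu₀ : u₀ ∈ Set.Ioo α β)
    (hu : IsSolUpTo γ f (Set.Ioo α β) u₀ u (maxTime γ f (Set.Ioo α β) u₀)) :
    ContinuousOn u {t : ℝ | 0 ≤ t ∧ ENNReal.ofReal t < maxTime γ f (Set.Ioo α β) u₀} ∧
    ∃ y : ℝ → ℝ,
      (∀ t : ℝ, 0 < t → ENNReal.ofReal t < maxTime γ f (Set.Ioo α β) u₀ →
        HasDerivAt u (y t) t) ∧
      ContinuousOn y {t : ℝ | 0 < t ∧ ENNReal.ofReal t < maxTime γ f (Set.Ioo α β) u₀} ∧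
      (∀ t : ℝ, 0 < t → ENNReal.ofReal t < maxTime γ f (Set.Ioo α β) u₀ →
        y t = (f u₀ / Real.Gamma γ) * t ^ (γ - 1)
          + (1 / Real.Gamma γ) * ∫ s in (0:ℝ)..t, s ^ (γ - 1) * f' (u (t - s)) * y (t - s)) ∧
      (y =O[𝓝[>] (0:ℝ)] fun t => t ^ (γ - 1)) ∧
      (f u₀ ≠ 0 →
        Tendsto (fun t => y t / ((f u₀ / Real.Gamma γ) * t ^ (γ - 1)))
          (𝓝[>] (0:ℝ)) (𝓝 1)) := by
  obtain ⟨hγ0, hγ1⟩ := hγ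
  obtain ⟨hu0, huc, hum, heq⟩ := hu
  have hc : ContinuousOn f' (Ioo α β) := by
    intro x hx
    obtain ⟨K, s, hs, hK⟩ := hf' x hx
    have hxs : x ∈ s := mem_of_mem_nhdsWithin hx hs
    exact (hK.continuousOn x hxs).mono_of_mem_nhdsWithin hs
  have hΓ := Real.Gamma_pos_of_pos hγ0
  generalize maxTime γ f (Ioo α β) u₀ = Tb at *
  refine ⟨huc, ?_⟩
  rcases eq_or_ne Tb 0 with hTb | hTb
  · subst hTb
    refine ⟨fun t => (f u₀ / Real.Gamma γ) * t ^ (γ - 1), ?_, ?_, ?_, ?_, ?_⟩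
    · intro t _ h
      simp at h
    · intro t h
      have := h.2
      simp at this
    · intro t _ h
      simp at h
    · exact isBigO_const_mul_self _ _ _
    · intro hf0
      apply Tendsto.congr' _ tendsto_const_nhds
      filter_upwards [self_mem_nhdsWithin] with t ht
      have := Real.rpow_pos_of_pos (mem_Ioi.1 ht) (γ - 1)
      field_simp
  -- local statement for `deriv u`
  have loc : ∀ t : ℝ, 0 ≤ t → ENNReal.ofReal t < Tb → ∃ T > t, ∃ M, ∃ C,
      (∀ t ∈ Ioo 0 T, HasDerivAt u (deriv u t) t) ∧
      (∀ t ∈ Ioo 0 T, ContinuousAt (deriv u) t) ∧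
      (∀ t ∈ Ioo 0 T, |deriv u t| ≤ M * t ^ (γ - 1)) ∧
      (∀ t ∈ Ioo 0 T, deriv u t = (f u₀ / Real.Gamma γ) * t ^ (γ - 1) +
        (1 / Real.Gamma γ) * ∫ s in (0:ℝ)..t, (t - s) ^ (γ - 1) * (f' (u s) * deriv u s)) ∧
      (∀ t ∈ Ioo 0 T,
        |deriv u t - (f u₀ / Real.Gamma γ) * t ^ (γ - 1)| ≤ C * t ^ (γ + γ - 1)) := by
    intro t ht htT
    obtain ⟨r, hr1, hr2⟩ := ENNReal.lt_iff_exists_nnreal_btwn.1 htT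
    have hr : t < (r : ℝ) := by
      have := (ENNReal.ofReal_lt_iff_lt_toReal ht ENNReal.coe_ne_top).1 hr1
      simpa using this
    have hmem : ∀ s ∈ Icc (0:ℝ) r, 0 ≤ s ∧ ENNReal.ofReal s < Tb := by
      intro s hs
      refine ⟨hs.1, lt_of_le_of_lt ?_ hr2⟩
      rw [← ENNReal.ofReal_coe_nnreal]
      exact ENNReal.ofReal_le_ofReal hs.2
    obtain ⟨y, M, C, h1, h2, h3, h4, h5⟩ := local_sol γ α β u₀ ((t + r) / 2) r f f' u hγ0 hγ1
      (by linarith) (by linarith) hderiv hc hu0 (huc.mono fun s hs => hmem s hs)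
      (fun s hs => hum s (hmem s hs).1 (hmem s hs).2)
      (fun s hs => heq s (hmem s hs).1 (hmem s hs).2)
    have hyd : ∀ s ∈ Ioo 0 ((t + r) / 2), deriv u s = y s := fun s hs => (h1 s hs).deriv
    refine ⟨(t + r) / 2, by linarith, M, C, ?_, ?_, ?_, ?_, ?_⟩
    · intro s hs
      rw [hyd s hs]
      exact h1 s hs
    · intro s hs
      apply (h2 s hs).congr
      filter_upwards [Ioo_mem_nhds hs.1 hs.2] with x hx
      exact (hyd x hx).symm
    · intro s hs
      rw [hyd s hs]
      exact h3 s hs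
    · intro s hs
      rw [hyd s hs, h4 s hs]
      congr 2
      apply intervalIntegral.integral_congr_ae
      filter_upwards with x hx
      rw [uIoc_of_le hs.1.le] at hx
      rw [hyd x ⟨hx.1, hx.2.trans_lt hs.2⟩]
    · intro s hs
      rw [hyd s hs]
      exact h5 s hs
  obtain ⟨T, hT, M, C, -, -, hb, -, hlim⟩ := loc 0 le_rfl (by simpa using pos_iff_ne_zero.2 hTb)
  refine ⟨deriv u, ?_, ?_, ?_, ?_, ?_⟩
  · intro t ht htT
    obtain ⟨T, hT, M, C, h1, h2, h3, h4, h5⟩ := loc t ht.le htT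
    exact h1 t ⟨ht, hT⟩
  · intro t ht
    obtain ⟨T, hT, M, C, h1, h2, h3, h4, h5⟩ := loc t ht.1.le ht.2
    exact (h2 t ⟨ht.1, hT⟩).continuousWithinAt
  · intro t ht htT
    obtain ⟨T, hT, M, C, h1, h2, h3, h4, h5⟩ := loc t ht.le htT
    rw [h4 t ⟨ht, hT⟩]
    congr 2
    have := intervalIntegral.integral_comp_sub_left (a := 0) (b := t)
      (fun s => (t - s) ^ (γ - 1) * (f' (u s) * deriv u s)) t
    simp only [sub_self, sub_zero, sub_sub_cancel] at this
    rw [← this]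
    simp only [mul_assoc]
  · apply IsBigO.of_bound M
    filter_upwards [Ioo_mem_nhdsGT hT] with t ht
    have hp := Real.rpow_pos_of_pos ht.1 (γ - 1)
    rw [Real.norm_eq_abs, Real.norm_eq_abs, abs_of_pos hp]
    exact hb t ht
  · intro hf0
    set c := f u₀ / Real.Gamma γ with hcdef
    have hc0 : c ≠ 0 := div_ne_zero hf0 hΓ.ne'
    rw [tendsto_iff_norm_sub_tendsto_zero]
    have hz : Tendsto (fun t : ℝ => C / |c| * t ^ γ) (𝓝[>] 0) (𝓝 0) := by
      have h1 : Continuous fun t : ℝ => C / |c| * t ^ γ :=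
        continuous_const.mul (Real.continuous_rpow_const hγ0.le)
      have h2 := (h1.tendsto 0).mono_left (nhdsWithin_le_nhds (s := Ioi 0))
      rw [Real.zero_rpow hγ0.ne', mul_zero] at h2
      exact h2
    apply squeeze_zero' (Eventually.of_forall fun t => norm_nonneg _) _ hz
    filter_upwards [Ioo_mem_nhdsGT hT] with t ht
    have hp := Real.rpow_pos_of_pos ht.1 (γ - 1)
    have hca : 0 < |c| := abs_pos.2 hc0
    have e : deriv u t / (c * t ^ (γ - 1)) - 1 = (deriv u t - c * t ^ (γ - 1)) / (c * t ^ (γ - 1)) := by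
      field_simp
    rw [e, Real.norm_eq_abs, abs_div, abs_mul, abs_of_pos hp, div_le_iff₀ (by positivity)]
    refine (hlim t ht).trans (le_of_eq ?_)
    rw [show γ + γ - 1 = γ + (γ - 1) by ring, Real.rpow_add ht.1]
    field_simp
end

section
/- Let γ ∈ (0,1), let f ∈ C¹(α, β) with f′ locally Lipschitz on (α, β), and let u be the unique solution of D_c^γ u = f(u) with u(0) = u₀ ∈ (α, β) on its maximal interval [0, T_b). Then u is monotone on (0, T_b); if moreover f(u₀) ≠ 0, then u is strictly monotone on (0, T_b) (strictly increasing if f(u₀) > 0, strictly decreasing if f(u₀) < 0). -/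
open MeasureTheory Real Filter Set Asymptotics
open scoped ENNReal Topology

lemma inner_int (γ ε s t : ℝ) (h0 : 0 < γ) (hε : 0 < ε) (hst : s ≤ t) :
    ∫ τ in s..t, γ * (t + ε - τ) ^ (-γ - 1) * (τ - s) ^ (γ - 1)
      = ε ^ (-γ) * ((t - s) ^ γ / (t - s + ε)) := by
  have ha : 0 < t - s + ε := by linarith
  have hd : ∀ x ∈ Ioo s t, HasDerivAt (fun τ => (t - s + ε)⁻¹ * ((τ - s) / (t + ε - τ)) ^ γ)
      (γ * (t + ε - x) ^ (-γ - 1) * (x - s) ^ (γ - 1)) x := by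
    intro x hx
    have h1 : 0 < x - s := by linarith [hx.1]
    have h2 : 0 < t + ε - x := by linarith [hx.2]
    have e1 : HasDerivAt (fun τ : ℝ => τ - s) 1 x := (hasDerivAt_id x).sub_const s
    have e2 : HasDerivAt (fun τ : ℝ => t + ε - τ) (-1) x := (hasDerivAt_id x).const_sub (t + ε)
    have e3 := ((e1.div e2 h2.ne').rpow_const (p := γ) (Or.inl (div_pos h1 h2).ne')).const_mul
      (t - s + ε)⁻¹
    refine e3.congr_deriv ?_
    change (t - s + ε)⁻¹ * ((1 * (t + ε - x) - (x - s) * -1) / (t + ε - x) ^ 2 * γ *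
      ((x - s) / (t + ε - x)) ^ (γ - 1)) = _
    rw [Real.div_rpow h1.le h2.le, show -γ - 1 = -(γ - 1) - 2 by ring, Real.rpow_sub h2 (-(γ - 1)) 2,
      Real.rpow_neg h2.le]
    have : (t + ε - x) ^ (γ - 1) ≠ 0 := (Real.rpow_pos_of_pos h2 _).ne'
    have h3 : (t + ε - x) ^ (2:ℝ) = (t + ε - x) ^ 2 := by norm_cast
    rw [h3]
    field_simp
    ring
  have hc : ContinuousOn (fun τ => (t - s + ε)⁻¹ * ((τ - s) / (t + ε - τ)) ^ γ) (Icc s t) := by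
    apply ContinuousOn.mul continuousOn_const
    apply ContinuousOn.rpow_const
    · apply ContinuousOn.div (by fun_prop) (by fun_prop)
      intro x hx
      linarith [hx.2]
    · intro x hx; right; exact h0.le
  have hn : ∀ x ∈ Ioo s t, 0 ≤ γ * (t + ε - x) ^ (-γ - 1) * (x - s) ^ (γ - 1) := by
    intro x hx
    have h1 : 0 < x - s := by linarith [hx.1]
    have h2 : 0 < t + ε - x := by linarith [hx.2]
    positivity
  have hi := intervalIntegral.integrableOn_deriv_of_nonneg hc hd hn
  rw [intervalIntegral.integral_eq_sub_of_hasDerivAt_of_le hst hc hd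
    ((intervalIntegrable_iff_integrableOn_Ioc_of_le hst).2 hi)]
  rw [sub_self, zero_div, Real.zero_rpow h0.ne', show t + ε - t = ε by ring,
    Real.div_rpow (by linarith) hε.le, Real.rpow_neg hε.le]
  field_simp
  ring

lemma k_mass (γ ε t : ℝ) (h0 : 0 < γ) (h1 : γ < 1) (hε : 0 < ε) (ht : ε ≤ t) :
    ∫ x in (0:ℝ)..t, ε ^ (1 - γ) * (x ^ (γ - 1) / (x + ε)) ≤ 1 / γ + 1 / (1 - γ) := by
  have hintg : ∀ a b : ℝ, 0 ≤ a → a ≤ b →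
      IntervalIntegrable (fun x => ε ^ (1 - γ) * (x ^ (γ - 1) / (x + ε))) volume a b := by
    intro a b ha hab
    have := (intervalIntegral.intervalIntegrable_rpow' (a := a) (b := b)
      (show -1 < γ - 1 by linarith)).mul_continuousOn (g := fun x => ε ^ (1 - γ) * (x + ε)⁻¹) (by
        apply ContinuousOn.mul continuousOn_const
        apply ContinuousOn.inv₀ (by fun_prop)
        intro x hx
        rw [uIcc_of_le hab] at hx
        linarith [hx.1])
    refine this.congr ?_
    intro x hx
    simp only
    ring
  rw [← intervalIntegral.integral_add_adjacent_intervals (hintg 0 ε le_rfl hε.le)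
    (hintg ε t hε.le ht)]
  apply add_le_add
  · calc _ ≤ ∫ x in (0:ℝ)..ε, ε ^ (-γ) * x ^ (γ - 1) := by
          apply intervalIntegral.integral_mono_on hε.le (hintg 0 ε le_rfl hε.le)
          · exact (intervalIntegral.intervalIntegrable_rpow' (by linarith)).const_mul _
          · intro x hx
            rw [show 1 - γ = 1 + -γ by ring, Real.rpow_add hε, Real.rpow_one]
            have : x ^ (γ - 1) / (x + ε) ≤ x ^ (γ - 1) / ε := by
              have := Real.rpow_nonneg hx.1 (γ - 1)
              gcongr
              linarith [hx.1]
            calc _ ≤ ε * ε ^ (-γ) * (x ^ (γ - 1) / ε) := by gcongr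
              _ = _ := by field_simp
      _ = 1 / γ := by
          rw [intervalIntegral.integral_const_mul, integral_rpow (Or.inl (by linarith))]
          simp only [sub_add_cancel]
          rw [Real.zero_rpow h0.ne', Real.rpow_neg hε.le]
          have := (Real.rpow_pos_of_pos hε γ).ne'
          field_simp
          ring
  · have hni : (0:ℝ) ∉ uIcc ε t := by
      rw [uIcc_of_le ht]; intro h; linarith [h.1]
    calc _ ≤ ∫ x in ε..t, ε ^ (1-γ) * x ^ (γ - 2) := by
          apply intervalIntegral.integral_mono_on ht (hintg ε t hε.le ht)
          · exact (intervalIntegral.intervalIntegrable_rpow (Or.inr hni)).const_mul _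
          · intro x hx
            have hx0 : 0 < x := lt_of_lt_of_le hε hx.1
            have e2 : x ^ (γ - 2) = x ^ (γ - 1) / x := by
              rw [show γ - 2 = (γ - 1) - 1 by ring, Real.rpow_sub_one hx0.ne' (γ - 1)]
            rw [e2]
            gcongr
            linarith
      _ ≤ 1 / (1 - γ) := by
          rw [intervalIntegral.integral_const_mul,
            integral_rpow (Or.inr ⟨by linarith, hni⟩)]
          have e : γ - 2 + 1 = -(1 - γ) := by ring
          rw [e, Real.rpow_neg hε.le]
          have p1 := Real.rpow_pos_of_pos hε (1 - γ)
          have p2 := Real.rpow_pos_of_pos (lt_of_lt_of_le hε ht) (-(1 - γ))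
          have : 0 < 1 - γ := by linarith
          rw [div_neg, mul_neg, ← mul_div_assoc, ← neg_div]
          gcongr
          rw [mul_sub, mul_inv_cancel₀ p1.ne']
          nlinarith [mul_pos p1 p2]

lemma fub (γ ε t B : ℝ) (Q V : ℝ → ℝ) (h0 : 0 < γ) (h1 : γ < 1) (hε : 0 < ε) (ht : 0 < t)
    (hQ : Measurable Q) (hB : ∀ s ∈ Icc 0 t, |Q s| ≤ B)
    (hV : ∀ τ ∈ Icc 0 t, V τ = ∫ s in (0:ℝ)..τ, (τ - s) ^ (γ - 1) * Q s) :
    ∫ τ in (0:ℝ)..t, γ * (t + ε - τ) ^ (-γ - 1) * V τ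
      = ∫ s in (0:ℝ)..t, Q s * (ε ^ (-γ) * ((t - s) ^ γ / (t - s + ε))) := by
  set F : ℝ → ℝ := indicator (Ioc 0 t) Q with hF
  set G : ℝ → ℝ := indicator (Ioc 0 t) (fun x => x ^ (γ - 1)) with hG
  set P : ℝ → ℝ := indicator (Ioc 0 t) (fun τ => γ * (t + ε - τ) ^ (-γ - 1)) with hP
  have z : (0:ℝ) ^ (γ - 1) = 0 := Real.zero_rpow (by linarith)
  have hFi : Integrable F := by
    rw [hF, integrable_indicator_iff measurableSet_Ioc]
    apply Measure.integrableOn_of_bounded (M := B) (by simp) hQ.aestronglyMeasurable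
    rw [ae_restrict_iff' measurableSet_Ioc]
    filter_upwards with s hs
    exact hB s ⟨hs.1.le, hs.2⟩
  have hGi : Integrable G := by
    rw [hG, integrable_indicator_iff measurableSet_Ioc,
      ← intervalIntegrable_iff_integrableOn_Ioc_of_le ht.le]
    exact intervalIntegral.intervalIntegrable_rpow' (by linarith)
  have hPm : Measurable P := by
    rw [hP]
    apply Measurable.indicator _ measurableSet_Ioc
    fun_prop
  have hPb : ∀ τ, ‖P τ‖ ≤ γ * ε ^ (-γ - 1) := by
    intro τ
    rw [hP, norm_indicator_eq_indicator_norm]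
    by_cases h : τ ∈ Ioc 0 t
    · rw [indicator_of_mem h]
      have : 0 < t + ε - τ := by linarith [h.2]
      rw [Real.norm_of_nonneg (by positivity)]
      apply mul_le_mul_of_nonneg_left _ h0.le
      apply Real.rpow_le_rpow_of_nonpos hε (by linarith [h.2]) (by linarith)
    · rw [indicator_of_notMem h]; positivity
  have hintg : Integrable (Function.uncurry fun τ s => P τ * (F s * G (τ - s)))
      (volume.prod volume) := by
    have h := hFi.convolution_integrand (ContinuousLinearMap.mul ℝ ℝ) hGi
    have := h.bdd_mul (f := fun p : ℝ × ℝ => P p.1) (c := γ * ε ^ (-γ - 1))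
      (hPm.comp measurable_fst).aestronglyMeasurable (by filter_upwards with p using hPb _)
    exact this
  have key := integral_integral_swap hintg
  have L : ∫ τ in (0:ℝ)..t, γ * (t + ε - τ) ^ (-γ - 1) * V τ
      = ∫ τ, ∫ s, P τ * (F s * G (τ - s)) := by
    rw [intervalIntegral.integral_of_le ht.le, ← integral_indicator measurableSet_Ioc]
    congr 1
    ext τ
    rw [integral_const_mul]
    by_cases h : τ ∈ Ioc 0 t
    · rw [hP, indicator_of_mem h, indicator_of_mem h, hV τ ⟨h.1.le, h.2⟩,
        intervalIntegral.integral_of_le h.1.le, ← integral_indicator measurableSet_Ioc]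
      congr 2
      ext s
      simp only [hF, hG, indicator, mem_Ioc]
      rcases lt_trichotomy s τ with hs | hs | hs
      · by_cases hs0 : 0 < s
        · rw [if_pos ⟨hs0, hs.le⟩, if_pos ⟨hs0, hs.le.trans h.2⟩,
            if_pos ⟨by linarith, by linarith [h.2]⟩, mul_comm]
        · rw [if_neg (fun x => hs0 x.1), if_neg (fun x => hs0 x.1), zero_mul]
      · subst hs
        simp [z]
      · rw [if_neg (fun x => absurd x.2 (by linarith)),
          if_neg (fun x : 0 < τ - s ∧ τ - s ≤ t => absurd x.1 (by linarith)), mul_zero]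
    · rw [hP, indicator_of_notMem h, indicator_of_notMem h, zero_mul]
  have R : ∫ s in (0:ℝ)..t, Q s * (ε ^ (-γ) * ((t - s) ^ γ / (t - s + ε)))
      = ∫ s, ∫ τ, P τ * (F s * G (τ - s)) := by
    rw [intervalIntegral.integral_of_le ht.le, ← integral_indicator measurableSet_Ioc]
    congr 1
    ext s
    have e : ∀ τ, P τ * (F s * G (τ - s)) = F s * (P τ * G (τ - s)) := fun τ => by ring
    simp_rw [e]
    rw [integral_const_mul]
    by_cases h : s ∈ Ioc 0 t
    · rw [hF, indicator_of_mem h, indicator_of_mem h, ← inner_int γ ε s t h0 hε h.2,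
        intervalIntegral.integral_of_le h.2, ← integral_indicator measurableSet_Ioc]
      congr 2
      ext τ
      simp only [hP, hG, indicator, mem_Ioc]
      by_cases a : s < τ ∧ τ ≤ t
      · rw [if_pos a, if_pos ⟨h.1.trans a.1, a.2⟩,
            if_pos ⟨by linarith [a.1], by linarith [a.2, h.1]⟩]
      · rw [if_neg a]
        by_cases b : 0 < τ ∧ τ ≤ t
        · rw [if_neg (fun x : 0 < τ - s ∧ τ - s ≤ t => a ⟨by linarith [x.1], b.2⟩), mul_zero]
        · rw [if_neg b, zero_mul]
    · rw [hF, indicator_of_notMem h, indicator_of_notMem h, zero_mul]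
  rw [L, R, key]

lemma ker_int (γ t B : ℝ) (Q : ℝ → ℝ) (h0 : 0 < γ) (ht : 0 ≤ t)
    (hQ : Measurable Q) (hB : ∀ s ∈ Icc 0 t, |Q s| ≤ B) (φ : ℝ → ℝ) (hφ : ContinuousOn φ (Icc 0 t)) :
    IntervalIntegrable (fun s => (t - s) ^ (γ - 1) * Q s * φ s) volume 0 t := by
  have h1 : IntervalIntegrable (fun s => (t - s) ^ (γ - 1)) volume 0 t := by
    have := (intervalIntegral.intervalIntegrable_rpow' (a := 0) (b := t)
      (show -1 < γ - 1 by linarith)).comp_sub_left t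
    simp only [sub_zero, sub_self] at this
    exact this.symm
  have h2 : IntervalIntegrable (fun s => (t - s) ^ (γ - 1) * Q s) volume 0 t := by
    rw [intervalIntegrable_iff_integrableOn_Ioc_of_le ht] at h1 ⊢
    have := h1.bdd_mul (f := Q) (c := B) hQ.aestronglyMeasurable (by
      rw [ae_restrict_iff' measurableSet_Ioc]
      filter_upwards with s hs
      exact hB s ⟨hs.1.le, hs.2⟩)
    refine this.congr ?_
    filter_upwards with s using mul_comm _ _
  exact h2.mul_continuousOn (by rwa [uIcc_of_le ht])

lemma core_s3 (γ t B L : ℝ) (Q V : ℝ → ℝ) (h0 : 0 < γ) (h1 : γ < 1) (ht : 0 < t)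
    (hQ : Measurable Q) (hB : ∀ s ∈ Icc 0 t, |Q s| ≤ B) (hL : 0 ≤ L) (hVc : Continuous V)
    (hV : ∀ τ ∈ Icc 0 t, V τ = ∫ s in (0:ℝ)..τ, (τ - s) ^ (γ - 1) * Q s)
    (hQV : ∀ s ∈ Icc 0 t, - (L * V s) ≤ Q s) (hpos : ∀ s ∈ Ioo 0 t, 0 < V s)
    (hz : V t = 0) : False := by
  have hV0 : V 0 = 0 := by rw [hV 0 ⟨le_rfl, ht.le⟩]; simp
  have hnn : ∀ s ∈ Icc 0 t, 0 ≤ V s := by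
    intro s hs
    rcases eq_or_lt_of_le hs.1 with h | h
    · rw [← h, hV0]
    rcases eq_or_lt_of_le hs.2 with h' | h'
    · rw [h', hz]
    exact (hpos s ⟨h, h'⟩).le
  obtain ⟨M, hM⟩ := (isCompact_Icc (a := (0:ℝ)) (b := t)).exists_bound_of_continuousOn hVc.continuousOn
  have hM0 : 0 ≤ M := (norm_nonneg _).trans (hM 0 ⟨le_rfl, ht.le⟩)
  set c := γ * (t + 1) ^ (-γ - 1) * ∫ τ in (0:ℝ)..t, V τ with hc
  have hcpos : 0 < c := by
    have : 0 < ∫ τ in (0:ℝ)..t, V τ :=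
      intervalIntegral.intervalIntegral_pos_of_pos_on (hVc.intervalIntegrable _ _) hpos ht
    positivity
  -- main inequality
  have main : ∀ ε, 0 < ε → ε < 1 →
      c ≤ L * ∫ s in (0:ℝ)..t, (t - s) ^ (γ - 1) * V s * (ε ^ (1 - γ) * (t - s + ε)⁻¹) := by
    intro ε hε hε1
    have hcon : ContinuousOn (fun s => ε ^ (1 - γ) * (t - s + ε)⁻¹) (Icc 0 t) := by
      apply ContinuousOn.mul continuousOn_const
      apply ContinuousOn.inv₀ (by fun_prop)
      intro x hx; linarith [hx.2]
    have iQ := ker_int γ t B Q h0 ht.le hQ hB _ hcon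
    have iQ1 := ker_int γ t B Q h0 ht.le hQ hB (fun _ => ε ^ (-γ)) continuousOn_const
    have iV := ker_int γ t M V h0 ht.le hVc.measurable hM _ hcon
    have e1 : c ≤ ∫ τ in (0:ℝ)..t, γ * (t + ε - τ) ^ (-γ - 1) * V τ := by
      rw [hc, ← intervalIntegral.integral_const_mul]
      apply intervalIntegral.integral_mono_on ht.le
      · exact (continuous_const.mul hVc).intervalIntegrable _ _
      · apply ContinuousOn.intervalIntegrable
        rw [uIcc_of_le ht.le]
        apply ContinuousOn.mul _ hVc.continuousOn
        apply ContinuousOn.mul continuousOn_const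
        apply ContinuousOn.rpow_const (by fun_prop)
        intro x hx; left; linarith [hx.2]
      · intro x hx
        apply mul_le_mul_of_nonneg_right _ (hnn x hx)
        apply mul_le_mul_of_nonneg_left _ h0.le
        apply Real.rpow_le_rpow_of_nonpos (by linarith [hx.2]) (by linarith [hx.1]) (by linarith)
    rw [fub γ ε t B Q V h0 h1 hε ht hQ hB hV] at e1
    have e2 : ∫ s in (0:ℝ)..t, Q s * (ε ^ (-γ) * ((t - s) ^ γ / (t - s + ε)))
        = ∫ s in (0:ℝ)..t, ((t - s) ^ (γ - 1) * Q s * ε ^ (-γ) -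
            (t - s) ^ (γ - 1) * Q s * (ε ^ (1 - γ) * (t - s + ε)⁻¹)) := by
      apply intervalIntegral.integral_congr
      intro s hs
      rw [uIcc_of_le ht.le] at hs
      simp only
      rcases eq_or_lt_of_le hs.2 with h | h
      · subst h
        simp [Real.zero_rpow h0.ne', Real.zero_rpow (show γ - 1 ≠ 0 by linarith)]
      · have p : 0 < t - s := by linarith
        rw [show 1 - γ = 1 + -γ by ring, Real.rpow_add hε, Real.rpow_one,
          Real.rpow_sub_one p.ne']
        field_simp
        ring
    rw [e2, intervalIntegral.integral_sub iQ1 iQ, intervalIntegral.integral_mul_const,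
      ← hV t ⟨ht.le, le_rfl⟩, hz, zero_mul, zero_sub, ← intervalIntegral.integral_neg] at e1
    refine e1.trans ?_
    rw [← intervalIntegral.integral_const_mul]
    apply intervalIntegral.integral_mono_on ht.le iQ.neg (iV.const_mul L)
    intro s hs
    have p1 : 0 ≤ (t - s) ^ (γ - 1) := Real.rpow_nonneg (by linarith [hs.2]) _
    have p2 : 0 ≤ ε ^ (1 - γ) * (t - s + ε)⁻¹ := by
      have : 0 < t - s + ε := by linarith [hs.2]
      positivity
    have := mul_nonneg (mul_nonneg p1 p2) (by linarith [hQV s hs] : 0 ≤ Q s + L * V s)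
    simp only [Pi.neg_apply]
    nlinarith [this]
  -- limit
  set K := 1 / γ + 1 / (1 - γ) with hK
  have hKpos : 0 < K := by
    have : 0 < 1 - γ := by linarith
    positivity
  set η := c / (2 * (L + 1) * K) with hη
  have hηpos : 0 < η := by positivity
  obtain ⟨δ, hδ, hδV⟩ : ∃ δ > 0, ∀ s, dist s t < δ → dist (V s) (V t) < η :=
    Metric.continuous_iff.1 hVc t η hηpos
  have bound : ∀ ε, 0 < ε → ε < 1 → ε ≤ t → c ≤ L * (η * K + M / δ * (t ^ γ / γ) * ε ^ (1 - γ)) := by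
    intro ε hε hε1 hεt
    refine (main ε hε hε1).trans (mul_le_mul_of_nonneg_left ?_ hL)
    have hcon : ContinuousOn (fun s => ε ^ (1 - γ) * (t - s + ε)⁻¹) (Icc 0 t) := by
      apply ContinuousOn.mul continuousOn_const
      apply ContinuousOn.inv₀ (by fun_prop)
      intro x hx; linarith [hx.2]
    have iV := ker_int γ t M V h0 ht.le hVc.measurable hM _ hcon
    have i1 := ker_int γ t 1 (fun _ => 1) h0 ht.le measurable_const (by simp) _ hcon
    have i2 := ker_int γ t 1 (fun _ => 1) h0 ht.le measurable_const (by simp) (fun _ => 1)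
      continuousOn_const
    have b1 : ∫ s in (0:ℝ)..t, (t - s) ^ (γ - 1) * 1 * (ε ^ (1 - γ) * (t - s + ε)⁻¹) ≤ K := by
      have := intervalIntegral.integral_comp_sub_left (a := 0) (b := t)
        (fun x => ε ^ (1 - γ) * (x ^ (γ - 1) / (x + ε))) t
      simp only [sub_zero, sub_self] at this
      refine le_trans (le_of_eq ?_) (k_mass γ ε t h0 h1 hε hεt)
      rw [← this]
      congr 1
      ext s
      ring
    have b2 : ∫ s in (0:ℝ)..t, (t - s) ^ (γ - 1) * 1 * 1 = t ^ γ / γ := by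
      have := intervalIntegral.integral_comp_sub_left (a := 0) (b := t)
        (fun x => x ^ (γ - 1)) t
      simp only [sub_zero, sub_self] at this
      simp only [mul_one]
      rw [this, integral_rpow (Or.inl (by linarith)), sub_add_cancel, Real.zero_rpow h0.ne',
        sub_zero]
    calc _ ≤ ∫ s in (0:ℝ)..t, (η * ((t - s) ^ (γ - 1) * 1 * (ε ^ (1 - γ) * (t - s + ε)⁻¹))
              + (M / δ * ε ^ (1 - γ)) * ((t - s) ^ (γ - 1) * 1 * 1)) := by
          apply intervalIntegral.integral_mono_on ht.le iV ((i1.const_mul _).add (i2.const_mul _))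
          intro s hs
          have p1 : 0 ≤ (t - s) ^ (γ - 1) := Real.rpow_nonneg (by linarith [hs.2]) _
          have p3 : 0 < t - s + ε := by linarith [hs.2]
          have p4 : 0 < ε ^ (1 - γ) := by positivity
          by_cases hsd : t - s < δ
          · have : V s ≤ η := by
              have := hδV s (by rw [dist_comm, Real.dist_eq, abs_of_nonneg (by linarith [hs.2])]; exact hsd)
              rw [hz, Real.dist_eq, sub_zero] at this
              exact (le_abs_self _).trans this.le
            have a1 : (t - s) ^ (γ - 1) * V s * (ε ^ (1 - γ) * (t - s + ε)⁻¹) ≤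
                (t - s) ^ (γ - 1) * η * (ε ^ (1 - γ) * (t - s + ε)⁻¹) := by gcongr
            have a2 : 0 ≤ (M / δ * ε ^ (1 - γ)) * ((t - s) ^ (γ - 1) * 1 * 1) := by positivity
            linarith
          · have : V s ≤ M := (le_abs_self _).trans (hM s hs)
            have a3 : (t - s + ε)⁻¹ ≤ δ⁻¹ := by
              apply inv_anti₀ hδ; linarith
            have a1 : (t - s) ^ (γ - 1) * V s * (ε ^ (1 - γ) * (t - s + ε)⁻¹) ≤
                (t - s) ^ (γ - 1) * M * (ε ^ (1 - γ) * δ⁻¹) := by gcongr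
            have a2 : 0 ≤ η * ((t - s) ^ (γ - 1) * 1 * (ε ^ (1 - γ) * (t - s + ε)⁻¹)) := by positivity
            have a4 : (M / δ * ε ^ (1 - γ)) * ((t - s) ^ (γ - 1) * 1 * 1) =
              (t - s) ^ (γ - 1) * M * (ε ^ (1 - γ) * δ⁻¹) := by ring
            linarith
      _ = η * (∫ s in (0:ℝ)..t, (t - s) ^ (γ - 1) * 1 * (ε ^ (1 - γ) * (t - s + ε)⁻¹))
            + (M / δ * ε ^ (1 - γ)) * (t ^ γ / γ) := by
          rw [intervalIntegral.integral_add (i1.const_mul _) (i2.const_mul _),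
            intervalIntegral.integral_const_mul, intervalIntegral.integral_const_mul, b2]
      _ ≤ η * K + (M / δ * ε ^ (1 - γ)) * (t ^ γ / γ) := by gcongr
      _ = _ := by ring
  have lim : Tendsto (fun ε : ℝ => L * (η * K + M / δ * (t ^ γ / γ) * ε ^ (1 - γ))) (𝓝[>] 0)
      (𝓝 (L * (η * K + M / δ * (t ^ γ / γ) * 0))) := by
    have : Tendsto (fun ε : ℝ => ε ^ (1 - γ)) (𝓝[>] 0) (𝓝 0) := by
      have := (Real.continuousAt_rpow_const 0 (1 - γ) (Or.inr (by linarith))).tendsto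
      rw [Real.zero_rpow (by linarith)] at this
      exact this.mono_left nhdsWithin_le_nhds
    exact ((this.const_mul _).const_add _).const_mul _
  have fin : c ≤ L * (η * K + M / δ * (t ^ γ / γ) * 0) := by
    apply ge_of_tendsto lim
    filter_upwards [Ioo_mem_nhdsGT (show (0:ℝ) < min 1 t by positivity)] with ε hε
    exact bound ε hε.1 (hε.2.trans_le (min_le_left _ _)) (hε.2.le.trans (min_le_right _ _))
  rw [mul_zero, add_zero] at fin
  have : L * (η * K) = c / 2 * (L / (L + 1)) := by
    rw [hη]; field_simp
  rw [this] at fin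
  have : L / (L + 1) ≤ 1 := by rw [div_le_one (by linarith)]; linarith
  nlinarith

lemma ker_int' (γ t : ℝ) (Q : ℝ → ℝ) (h0 : 0 < γ) (ht : 0 ≤ t) (hQ : Continuous Q) :
    IntervalIntegrable (fun s => (t - s) ^ (γ - 1) * Q s) volume 0 t := by
  have := ker_int γ t 1 (fun _ => 1) h0 ht measurable_const (by simp) Q hQ.continuousOn
  simpa using this

lemma mono_pos (γ S C L u₀ : ℝ) (u F : ℝ → ℝ) (h0 : 0 < γ) (h1 : γ < 1) (hC : 0 < C) (hL : 0 ≤ L)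
    (hu : Continuous u) (hF : Continuous F)
    (hlip : ∀ s ∈ Icc 0 S, ∀ r ∈ Icc 0 S, |F s - F r| ≤ L * |u s - u r|)
    (heq : ∀ t ∈ Icc 0 S, u t = u₀ + C * ∫ s in (0:ℝ)..t, (t - s) ^ (γ - 1) * F s)
    (hF0 : 0 < F 0) : StrictMonoOn u (Icc 0 S) := by
  rcases le_or_gt S 0 with hS | hS
  · intro a ha b hb hab
    linarith [ha.1, hb.2]
  have hu0 : u 0 = u₀ := by rw [heq 0 ⟨le_rfl, hS.le⟩]; simp
  obtain ⟨h₀, hh₀, hFpos⟩ : ∃ h₀ > 0, ∀ s ∈ Icc 0 h₀, 0 < F s := by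
    obtain ⟨d, hd, h⟩ := Metric.continuous_iff.1 hF 0 (F 0) hF0
    refine ⟨d / 2, by positivity, fun s hs => ?_⟩
    have := h s (by rw [Real.dist_eq, sub_zero, abs_of_nonneg hs.1]; linarith [hs.2])
    rw [Real.dist_eq] at this
    linarith [(abs_lt.1 this).1]
  -- initial growth
  have hgrow : ∀ t, 0 < t → t ≤ h₀ → t ≤ S → u₀ < u t := by
    intro t ht hth htS
    rw [heq t ⟨ht.le, htS⟩]
    have : 0 < ∫ s in (0:ℝ)..t, (t - s) ^ (γ - 1) * F s := by
      apply intervalIntegral.intervalIntegral_pos_of_pos_on (ker_int' γ t F h0 ht.le hF) _ ht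
      intro s hs
      exact mul_pos (Real.rpow_pos_of_pos (by linarith [hs.2]) _) (hFpos s ⟨hs.1.le, by linarith [hs.2]⟩)
    have := mul_pos hC this
    linarith
  -- one step
  have step : ∀ h, 0 < h → h ≤ h₀ → ∀ τ, h ≤ τ → τ ≤ S → u (τ - h) < u τ := by
    intro h hh hh0
    by_contra! hcon
    obtain ⟨τ₀, hτ1, hτ2, hτ3⟩ := hcon
    set V : ℝ → ℝ := fun τ => u τ - u (max (τ - h) 0) with hVdef
    have hVc : Continuous V := by rw [hVdef]; fun_prop
    have hVini : ∀ τ, 0 < τ → τ ≤ h → τ ≤ S → 0 < V τ := by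
      intro τ a b c
      simp only [hVdef]
      rw [max_eq_right (by linarith), hu0]
      linarith [hgrow τ a (b.trans hh0) c]
    have hcpt : IsCompact (Icc h S ∩ {τ | V τ ≤ 0}) :=
      isCompact_Icc.inter_right (isClosed_le hVc continuous_const)
    obtain ⟨t, ⟨⟨hht, htS⟩, htV⟩, hleast⟩ := hcpt.exists_isLeast ⟨τ₀, ⟨hτ1, hτ2⟩, by
      simp only [hVdef, mem_ofPred_eq]
      rw [max_eq_left (by linarith)]; linarith⟩
    simp only [mem_ofPred_eq] at htV
    have ht0 : 0 < t := by linarith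
    have hpos : ∀ s ∈ Ioo 0 t, 0 < V s := by
      intro s hs
      rcases le_or_gt s h with a | a
      · exact hVini s hs.1 a (by linarith [hs.2])
      · by_contra b
        have := hleast ⟨⟨a.le, by linarith [hs.2]⟩, not_lt.1 b⟩
        linarith [hs.2]
    have hz : V t = 0 := by
      apply le_antisymm htV
      have : t ∈ closure (Ioo 0 t) := by
        rw [closure_Ioo ht0.ne]; exact ⟨ht0.le, le_rfl⟩
      exact closure_minimal (fun s hs => (hpos s hs).le) (isClosed_le continuous_const hVc) this
    have hV0 : V 0 = 0 := by
      simp only [hVdef]; rw [max_eq_right (by linarith)]; ring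
    have hnn : ∀ s ∈ Icc 0 t, 0 ≤ V s := by
      intro s hs
      rcases eq_or_lt_of_le hs.1 with e | e
      · rw [← e, hV0]
      rcases eq_or_lt_of_le hs.2 with e' | e'
      · rw [e', hz]
      exact (hpos s ⟨e, e'⟩).le
    set G : ℝ → ℝ := indicator (Ioi h) (fun s => F (s - h)) with hG
    have hGm : Measurable G := by
      rw [hG]
      apply Measurable.indicator _ measurableSet_Ioi
      exact (hF.comp (continuous_id.sub continuous_const)).measurable
    obtain ⟨M1, hM1⟩ := (isCompact_Icc (a := (0:ℝ)) (b := t)).exists_bound_of_continuousOn hF.continuousOn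
    have hGb : ∀ s ∈ Icc 0 t, |G s| ≤ M1 := by
      intro s hs
      by_cases a : s ∈ Ioi h
      · rw [hG, indicator_of_mem a]
        simp only [mem_Ioi] at a
        exact hM1 _ ⟨by linarith, by linarith [hs.2]⟩
      · rw [hG, indicator_of_notMem a, abs_zero]
        exact (norm_nonneg _).trans (hM1 s hs)
    have iG : ∀ τ ∈ Icc 0 t, IntervalIntegrable (fun s => (τ - s) ^ (γ - 1) * G s) volume 0 τ := by
      intro τ hτ
      have := ker_int γ τ M1 G h0 hτ.1 hGm (fun s hs => hGb s ⟨hs.1, hs.2.trans hτ.2⟩) (fun _ => 1)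
        continuousOn_const
      simpa using this
    have hGint : ∀ τ ∈ Icc 0 t, u (max (τ - h) 0) = u₀ + C * ∫ s in (0:ℝ)..τ, (τ - s) ^ (γ - 1) * G s := by
      intro τ hτ
      have zero : ∀ b, 0 ≤ b → b ≤ h → ∫ s in (0:ℝ)..b, (τ - s) ^ (γ - 1) * G s = 0 := by
        intro b hb hbh
        refine intervalIntegral.integral_zero_ae ?_
        filter_upwards with s hs
        rw [uIoc_of_le hb] at hs
        have : s ∉ Ioi h := by simp only [mem_Ioi, not_lt]; linarith [hs.2]
        simp only [hG]
        rw [indicator_of_notMem this, mul_zero]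
      rcases le_or_gt τ h with a | a
      · rw [max_eq_right (by linarith), hu0, zero τ hτ.1 a]; ring
      · rw [max_eq_left (by linarith), heq (τ - h) ⟨by linarith, by linarith [hτ.2]⟩]
        congr 2
        have i1 := (iG τ hτ).mono_set (c := 0) (d := h) (by
          rw [uIcc_of_le hh.le, uIcc_of_le hτ.1]; exact Icc_subset_Icc_right a.le)
        have i2 := (iG τ hτ).mono_set (c := h) (d := τ) (by
          rw [uIcc_of_le a.le, uIcc_of_le hτ.1]; exact Icc_subset_Icc_left hh.le)
        rw [← intervalIntegral.integral_add_adjacent_intervals i1 i2, zero h hh.le le_rfl, zero_add]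
        have := intervalIntegral.integral_comp_sub_right (a := h) (b := τ)
          (fun s => (τ - h - s) ^ (γ - 1) * F s) h
        rw [sub_self] at this
        rw [← this]
        apply intervalIntegral.integral_congr_ae
        filter_upwards with s hs
        rw [uIoc_of_le a.le] at hs
        simp only [hG]
        rw [indicator_of_mem (show s ∈ Ioi h from hs.1)]
        congr 2
        ring
    refine core_s3 γ t (C * (M1 + M1)) (C * L) (fun s => C * (F s - G s)) V h0 h1 ht0
      ((hF.measurable.sub hGm).const_mul C) ?_ (by positivity) hVc ?_ ?_ hpos hz
    · intro s hs
      rw [abs_mul, abs_of_pos hC]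
      apply mul_le_mul_of_nonneg_left _ hC.le
      exact (abs_sub _ _).trans (add_le_add (hM1 s hs) (hGb s hs))
    · intro τ hτ
      have e : ∀ s, (τ - s) ^ (γ - 1) * (C * (F s - G s)) =
        C * ((τ - s) ^ (γ - 1) * F s - (τ - s) ^ (γ - 1) * G s) := fun s => by ring
      simp_rw [e]
      rw [intervalIntegral.integral_const_mul,
        intervalIntegral.integral_sub (ker_int' γ τ F h0 hτ.1 hF) (iG τ hτ)]
      simp only [hVdef]
      rw [heq τ ⟨hτ.1, hτ.2.trans htS⟩, hGint τ hτ]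
      ring
    · intro s hs
      have hv := hnn s hs
      rcases le_or_gt s h with a | a
      · have hg : G s = 0 := by
          rw [hG]; exact indicator_of_notMem (by simp only [mem_Ioi, not_lt]; exact a) _
        simp only [hg, sub_zero]
        have := hFpos s ⟨hs.1, a.trans hh0⟩
        have : 0 ≤ C * F s := by positivity
        have : 0 ≤ C * L * V s := by positivity
        linarith
      · have hg : G s = F (s - h) := by
          rw [hG]; exact indicator_of_mem (show s ∈ Ioi h from a) _
        have hvs : V s = u s - u (s - h) := by
          simp only [hVdef]; rw [max_eq_left (by linarith)]
        have := hlip s ⟨hs.1, hs.2.trans htS⟩ (s - h) ⟨by linarith, by linarith [hs.2]⟩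
        rw [← hvs, abs_of_nonneg hv] at this
        have := (abs_le.1 this).1
        simp only [hg]
        nlinarith [mul_le_mul_of_nonneg_left this hC.le]
  -- chaining
  have chain : ∀ n : ℕ, ∀ a b, 0 ≤ a → b ≤ S → a < b → b - a ≤ n * h₀ → u a < u b := by
    intro n
    induction n with
    | zero => intro a b _ _ hab h; simp at h; linarith
    | succ n ih =>
      intro a b ha hb hab h
      push_cast at h
      rcases le_or_gt (b - a) h₀ with c | c
      · have := step (b - a) (by linarith) c b (by linarith) hb
        rwa [sub_sub_cancel] at this
      · have := step h₀ hh₀ le_rfl b (by linarith) hb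
        exact (ih a (b - h₀) ha (by linarith) (by linarith) (by linarith)).trans this
  intro a ha b hb hab
  obtain ⟨n, hn⟩ := exists_nat_ge ((b - a) / h₀)
  exact chain n a b ha.1 hb.2 hab ((div_le_iff₀ hh₀).1 hn)

lemma const_zero (γ S C L u₀ : ℝ) (u F : ℝ → ℝ) (h0 : 0 < γ) (hC : 0 < C) (hL : 0 ≤ L)
    (hS : 0 ≤ S) (hu : Continuous u)
    (hlip : ∀ s ∈ Icc 0 S, |F s| ≤ L * |u s - u₀|)
    (heq : ∀ t ∈ Icc 0 S, u t = u₀ + C * ∫ s in (0:ℝ)..t, (t - s) ^ (γ - 1) * F s) :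
    ∀ t ∈ Icc 0 S, u t = u₀ := by
  have hΓ := Real.Gamma_pos_of_pos h0
  set A := C * L * Real.Gamma γ with hA
  have hA0 : 0 ≤ A := by positivity
  set μ := (1 / (A + 1)) ^ (1 / γ) with hμ
  have hμ0 : 0 < μ := by positivity
  have hμγ : μ ^ γ = 1 / (A + 1) := by
    rw [hμ, ← Real.rpow_mul (by positivity), one_div_mul_cancel h0.ne', Real.rpow_one]
  set l := 1 / μ with hl
  have hl0 : 0 < l := by positivity
  obtain ⟨t, ht, hmax⟩ := (isCompact_Icc (a := (0:ℝ)) (b := S)).exists_isMaxOn ⟨0, le_rfl, hS⟩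
    (f := fun t => Real.exp (-(l * t)) * |u t - u₀|) (by fun_prop)
  set M := Real.exp (-(l * t)) * |u t - u₀| with hM
  have hM0 : 0 ≤ M := by positivity
  have hb : ∀ s ∈ Icc 0 S, |u s - u₀| ≤ M * Real.exp (l * s) := by
    intro s hs
    have h : Real.exp (-(l * s)) * |u s - u₀| ≤ M := hmax hs
    calc |u s - u₀| = (Real.exp (-(l * s)) * |u s - u₀|) * Real.exp (l * s) := by
          rw [mul_right_comm, ← Real.exp_add]; simp
      _ ≤ _ := by gcongr
  have hker : ∫ s in (0:ℝ)..t, (t - s) ^ (γ - 1) * Real.exp (-(l * (t - s))) ≤ μ ^ γ * Real.Gamma γ := by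
    have e := intervalIntegral.integral_comp_sub_left (a := 0) (b := t)
      (fun x => x ^ (γ - 1) * Real.exp (-(l * x))) t
    simp only [sub_zero, sub_self] at e
    have e2 := Real.integral_rpow_mul_exp_neg_mul_Ioi h0 hl0
    have : 1 / l = μ := by rw [hl]; simp
    rw [this] at e2
    rw [e, ← e2, intervalIntegral.integral_of_le ht.1]
    apply setIntegral_mono_set
    · by_contra hni
      rw [integral_undef hni] at e2
      have : 0 < μ ^ γ * Real.Gamma γ := by positivity
      linarith
    · rw [EventuallyLE, ae_restrict_iff' measurableSet_Ioi]
      filter_upwards with x hx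
      have : (0:ℝ) < x := hx
      simp only [Pi.zero_apply]
      positivity
    · exact Ioc_subset_Ioi_self.eventuallyLE
  have h2 : |u t - u₀| ≤ C * (L * M * Real.exp (l * t) * (μ ^ γ * Real.Gamma γ)) := by
    rw [heq t ht, add_sub_cancel_left, abs_mul, abs_of_pos hC]
    apply mul_le_mul_of_nonneg_left _ hC.le
    calc _ ≤ ∫ s in (0:ℝ)..t, L * M * Real.exp (l * t) * ((t - s) ^ (γ - 1) * Real.exp (-(l * (t - s)))) := by
          rw [← Real.norm_eq_abs]
          apply intervalIntegral.norm_integral_le_of_norm_le ht.1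
          · filter_upwards with s hs
            have p : 0 ≤ (t - s) ^ (γ - 1) := Real.rpow_nonneg (by linarith [hs.2]) _
            rw [norm_mul, Real.norm_of_nonneg p, Real.norm_eq_abs]
            have hs' : s ∈ Icc 0 S := ⟨hs.1.le, hs.2.trans ht.2⟩
            calc _ ≤ (t - s) ^ (γ - 1) * (L * (M * Real.exp (l * s))) := by
                  apply mul_le_mul_of_nonneg_left _ p
                  exact (hlip s hs').trans (mul_le_mul_of_nonneg_left (hb s hs') hL)
              _ = _ := by
                  have : Real.exp (l * s) = Real.exp (l * t) * Real.exp (-(l * (t - s))) := by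
                    rw [← Real.exp_add]; congr 1; ring
                  rw [this]; ring
          · exact (ker_int' γ t _ h0 ht.1 (by fun_prop)).const_mul _
      _ ≤ _ := by
          rw [intervalIntegral.integral_const_mul]
          gcongr
  have h3 : M ≤ A * (1 / (A + 1)) * M := by
    rw [← hμγ]
    calc M ≤ Real.exp (-(l * t)) * (C * (L * M * Real.exp (l * t) * (μ ^ γ * Real.Gamma γ))) := by
          rw [hM]; gcongr
      _ = (Real.exp (-(l * t)) * Real.exp (l * t)) * (A * μ ^ γ * M) := by rw [hA]; ring
      _ = _ := by rw [← Real.exp_add]; simp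
  have h4 : A * (1 / (A + 1)) = 1 - 1 / (A + 1) := by field_simp; ring
  have h5 : 0 < 1 / (A + 1) := by positivity
  have h6 : M = 0 := by
    rw [h4] at h3
    nlinarith
  intro s hs
  have := hb s hs
  rw [h6, zero_mul] at this
  have := abs_nonpos_iff.1 this
  linarith

lemma red (γ α β u₀ S : ℝ) (f f' : ℝ → ℝ) (u : ℝ → ℝ) (T : ℝ≥0∞)
    (hγ : γ ∈ Set.Ioo (0:ℝ) 1)
    (hderiv : ∀ x ∈ Set.Ioo α β, HasDerivAt f (f' x) x)
    (hf' : ∀ x ∈ Set.Ioo α β, ∃ K : NNReal, ∃ s ∈ 𝓝[Set.Ioo α β] x, LipschitzOnWith K f' s)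
    (hu : IsSolUpTo γ f (Set.Ioo α β) u₀ u T) (hS : 0 ≤ S) (hST : ENNReal.ofReal S < T) :
    (f u₀ = 0 → ∀ t ∈ Icc 0 S, u t = u₀) ∧ (0 < f u₀ → StrictMonoOn u (Icc 0 S)) ∧
    (f u₀ < 0 → StrictAntiOn u (Icc 0 S)) := by
  obtain ⟨hu0, huc, huD, hueq⟩ := hu
  have hT : ∀ t ∈ Icc 0 S, ENNReal.ofReal t < T := fun t ht =>
    (ENNReal.ofReal_le_ofReal ht.2).trans_lt hST
  have huc' : ContinuousOn u (Icc 0 S) := huc.mono (fun t ht => ⟨ht.1, hT t ht⟩)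
  set v : ℝ → ℝ := fun t => u (max 0 (min S t)) with hv
  have hproj : ∀ t, max 0 (min S t) ∈ Icc 0 S := fun t =>
    ⟨le_max_left _ _, max_le hS (min_le_left _ _)⟩
  have hvc : Continuous v := huc'.comp_continuous (by fun_prop) hproj
  have hvu : ∀ t ∈ Icc 0 S, v t = u t := by
    intro t ht
    simp only [hv]
    rw [min_eq_right ht.2, max_eq_right ht.1]
  have hvD : ∀ t, v t ∈ Ioo α β := fun t => huD _ (hproj t).1 (hT _ (hproj t))
  have hfc : ContinuousOn f (Ioo α β) := fun x hx => (hderiv x hx).continuousAt.continuousWithinAt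
  have hFc : Continuous (fun t => f (v t)) := hfc.comp_continuous hvc hvD
  have hf'c : ContinuousOn f' (Ioo α β) := by
    intro x hx
    obtain ⟨K, s, hs, hK⟩ := hf' x hx
    rw [isOpen_Ioo.nhdsWithin_eq hx] at hs
    exact (hK.continuousOn.continuousAt hs).continuousWithinAt
  obtain ⟨a, ha, hmin⟩ := (isCompact_Icc (a := (0:ℝ)) (b := S)).exists_isMinOn ⟨0, le_rfl, hS⟩
    hvc.continuousOn
  obtain ⟨b, hb, hmax⟩ := (isCompact_Icc (a := (0:ℝ)) (b := S)).exists_isMaxOn ⟨0, le_rfl, hS⟩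
    hvc.continuousOn
  have hsub : Icc (v a) (v b) ⊆ Ioo α β := fun x hx =>
    ⟨(hvD a).1.trans_le hx.1, hx.2.trans_lt (hvD b).2⟩
  obtain ⟨L, hL⟩ := (isCompact_Icc (a := v a) (b := v b)).exists_bound_of_continuousOn
    (hf'c.mono hsub)
  have hL0 : 0 ≤ L := (norm_nonneg _).trans (hL (v a) ⟨le_rfl, hmin hb⟩)
  have hlip : ∀ s ∈ Icc 0 S, ∀ r ∈ Icc 0 S, |f (v s) - f (v r)| ≤ L * |v s - v r| := by
    intro s hs r hr
    exact (convex_Icc (v a) (v b)).norm_image_sub_le_of_norm_hasDerivWithin_le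
      (fun x hx => (hderiv x (hsub hx)).hasDerivWithinAt) hL ⟨hmin hr, hmax hr⟩ ⟨hmin hs, hmax hs⟩
  have heq : ∀ t ∈ Icc 0 S, v t = u₀ + (1 / Real.Gamma γ) *
      ∫ s in (0:ℝ)..t, (t - s) ^ (γ - 1) * f (v s) := by
    intro t ht
    rw [hvu t ht, hueq t ht.1 (hT t ht)]
    congr 2
    apply intervalIntegral.integral_congr
    intro s hs
    rw [uIcc_of_le ht.1] at hs
    simp only
    rw [hvu s ⟨hs.1, hs.2.trans ht.2⟩]
  have hC : 0 < 1 / Real.Gamma γ := one_div_pos.2 (Real.Gamma_pos_of_pos hγ.1)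
  have h0S : (0:ℝ) ∈ Icc 0 S := ⟨le_rfl, hS⟩
  have hv0 : v 0 = u₀ := by rw [hvu 0 h0S, hu0]
  refine ⟨fun hz t ht => ?_, fun hp => ?_, fun hn => ?_⟩
  · rw [← hvu t ht]
    refine const_zero γ S _ L u₀ v (fun t => f (v t)) hγ.1 hC hL0 hS hvc ?_ heq t ht
    intro s hs
    have := hlip s hs 0 h0S
    rwa [hv0, hz, sub_zero] at this
  · have := mono_pos γ S _ L u₀ v (fun t => f (v t)) hγ.1 hγ.2 hC hL0 hvc hFc hlip heq
      (by simpa only [hv0] using hp)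
    intro x hx y hy hxy
    rw [← hvu x hx, ← hvu y hy]
    exact this hx hy hxy
  · have := mono_pos γ S _ L (-u₀) (fun t => - v t) (fun t => - f (v t)) hγ.1 hγ.2 hC hL0 hvc.neg
      hFc.neg (by
        intro s hs r hr
        have := hlip r hr s hs
        rw [show -f (v s) - -f (v r) = f (v r) - f (v s) by ring,
          show -v s - -v r = v r - v s by ring]
        exact this) (by
        intro t ht
        simp only [mul_neg, intervalIntegral.integral_neg]
        rw [heq t ht]; ring)
      (by simp only [hv0]; linarith)
    intro x hx y hy hxy
    rw [← hvu x hx, ← hvu y hy]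
    have := this hx hy hxy
    simp only at this
    linarith

/-- monotonicity of solutions of autonomous fractional ODEs. -/
theorem stmt3 (γ α β u₀ : ℝ) (f f' : ℝ → ℝ) (u : ℝ → ℝ)
    (hγ : γ ∈ Set.Ioo (0:ℝ) 1) (hαβ : α < β)
    (hderiv : ∀ x ∈ Set.Ioo α β, HasDerivAt f (f' x) x)
    (hf' : ∀ x ∈ Set.Ioo α β, ∃ K : NNReal, ∃ s ∈ 𝓝[Set.Ioo α β] x, LipschitzOnWith K f' s)
    (hu₀ : u₀ ∈ Set.Ioo α β)
    (hu : IsSolUpTo γ f (Set.Ioo α β) u₀ u (maxTime γ f (Set.Ioo α β) u₀)) :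
    (MonotoneOn u {t : ℝ | 0 < t ∧ ENNReal.ofReal t < maxTime γ f (Set.Ioo α β) u₀} ∨
      AntitoneOn u {t : ℝ | 0 < t ∧ ENNReal.ofReal t < maxTime γ f (Set.Ioo α β) u₀}) ∧
    (0 < f u₀ →
      StrictMonoOn u {t : ℝ | 0 < t ∧ ENNReal.ofReal t < maxTime γ f (Set.Ioo α β) u₀}) ∧
    (f u₀ < 0 →
      StrictAntiOn u {t : ℝ | 0 < t ∧ ENNReal.ofReal t < maxTime γ f (Set.Ioo α β) u₀}) := by
  have R := fun S => red γ α β u₀ S f f' u _ hγ hderiv hf' hu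
  have P : 0 < f u₀ →
      StrictMonoOn u {t : ℝ | 0 < t ∧ ENNReal.ofReal t < maxTime γ f (Set.Ioo α β) u₀} := by
    intro h x hx y hy hxy
    exact (R y hy.1.le hy.2).2.1 h ⟨hx.1.le, hxy.le⟩ ⟨hy.1.le, le_rfl⟩ hxy
  have N : f u₀ < 0 →
      StrictAntiOn u {t : ℝ | 0 < t ∧ ENNReal.ofReal t < maxTime γ f (Set.Ioo α β) u₀} := by
    intro h x hx y hy hxy
    exact (R y hy.1.le hy.2).2.2 h ⟨hx.1.le, hxy.le⟩ ⟨hy.1.le, le_rfl⟩ hxy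
  refine ⟨?_, P, N⟩
  rcases lt_trichotomy (f u₀) 0 with h | h | h
  · exact Or.inr (N h).antitoneOn
  · left
    intro x hx y hy _
    rw [(R x hx.1.le hx.2).1 h x ⟨hx.1.le, le_rfl⟩, (R y hy.1.le hy.2).1 h y ⟨hy.1.le, le_rfl⟩]
  · exact Or.inl (P h).monotoneOn
end

section
/- Let γ ∈ (0,1), T > 0, v ∈ C⁰[0,T], and α > 0. Then the Volterra integral equation y(t) + ∫₀ᵗ (t−s)^{γ−1} v(s) y(s) ds = α t^{γ−1}, t ∈ (0,T], has a unique solution y ∈ L¹[0,T], and this solution satisfies y(t) > 0 for almost every t ∈ [0,T]. -/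
open MeasureTheory Real Filter Set
open scoped ENNReal Topology

noncomputable section

/-- convolution on the line -/
def cv (f g : ℝ → ℝ) (x : ℝ) : ℝ := ∫ s, f (x - s) * g s

lemma cv_eq (f g : ℝ → ℝ) : cv f g = convolution f g (ContinuousLinearMap.mul ℝ ℝ) volume := by
  funext x
  rw [convolution_eq_swap]
  simp [cv]

lemma cv_ae {f g : ℝ → ℝ} (hf : Integrable f) (hg : Integrable g) :
    ∀ᵐ x, Integrable (fun s => f (x - s) * g s) := by
  have h := hf.ae_convolution_exists (ContinuousLinearMap.mul ℝ ℝ) hg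
  filter_upwards [h] with x hx
  simpa using hx.integrable_swap

lemma cv_int {f g : ℝ → ℝ} (hf : Integrable f) (hg : Integrable g) : Integrable (cv f g) := by
  rw [cv_eq]
  exact hf.integrable_convolution (ContinuousLinearMap.mul ℝ ℝ) hg

lemma cv_integral {f g : ℝ → ℝ} (hf : Integrable f) (hg : Integrable g) :
    ∫ x, cv f g x = (∫ x, f x) * ∫ x, g x := by
  rw [cv_eq, integral_convolution (ContinuousLinearMap.mul ℝ ℝ) hf hg]
  simp

lemma cv_abs_le (f g : ℝ → ℝ) (x : ℝ) :
    |cv f g x| ≤ cv (fun s => |f s|) (fun s => |g s|) x := by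
  have := norm_integral_le_integral_norm (μ := volume) (fun s => f (x - s) * g s)
  simpa [cv, abs_mul] using this

lemma cv_norm {f g : ℝ → ℝ} (hf : Integrable f) (hg : Integrable g) :
    ∫ x, |cv f g x| ≤ (∫ x, |f x|) * ∫ x, |g x| := by
  rw [← cv_integral hf.abs hg.abs]
  exact integral_mono (cv_int hf hg).abs (cv_int hf.abs hg.abs) (cv_abs_le f g)

lemma cv_congr {f f' g g' : ℝ → ℝ} (hf : f =ᵐ[volume] f') (hg : g =ᵐ[volume] g') :
    cv f g = cv f' g' := by
  rw [cv_eq, cv_eq]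
  exact convolution_congr _ hf hg

lemma cv_assoc {f g h : ℝ → ℝ} (hf : Integrable f) (hg : Integrable g) (hh : Integrable h) :
    ∀ᵐ x, cv (cv f g) h x = cv f (cv g h) x := by
  have h1 := hf.norm.ae_convolution_exists (ContinuousLinearMap.mul ℝ ℝ)
    (hg.norm.integrable_convolution (ContinuousLinearMap.mul ℝ ℝ) hh.norm)
  filter_upwards [h1] with x hx
  simp only [cv_eq]
  exact convolution_assoc (ContinuousLinearMap.mul ℝ ℝ) (ContinuousLinearMap.mul ℝ ℝ)
    (ContinuousLinearMap.mul ℝ ℝ) (ContinuousLinearMap.mul ℝ ℝ)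
    (fun x y z => by simp [mul_assoc]) hf.aestronglyMeasurable hg.aestronglyMeasurable
    hh.aestronglyMeasurable (hf.ae_convolution_exists _ hg)
    (hg.norm.ae_convolution_exists _ hh.norm) hx

lemma cv_add_right {f g h : ℝ → ℝ} (hf : Integrable f) (hg : Integrable g) (hh : Integrable h) :
    ∀ᵐ x, cv f (fun s => g s + h s) x = cv f g x + cv f h x := by
  filter_upwards [cv_ae hf hg, cv_ae hf hh] with x h1 h2
  simp only [cv, mul_add]
  exact integral_add h1 h2

lemma cv_sub_right {f g h : ℝ → ℝ} (hf : Integrable f) (hg : Integrable g) (hh : Integrable h) :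
    ∀ᵐ x, cv f (fun s => g s - h s) x = cv f g x - cv f h x := by
  filter_upwards [cv_ae hf hg, cv_ae hf hh] with x h1 h2
  simp only [cv, mul_sub]
  exact integral_sub h1 h2

lemma cv_add_left {f g h : ℝ → ℝ} (hf : Integrable f) (hg : Integrable g) (hh : Integrable h) :
    ∀ᵐ x, cv (fun s => f s + g s) h x = cv f h x + cv g h x := by
  filter_upwards [cv_ae hf hh, cv_ae hg hh] with x h1 h2
  simp only [cv, add_mul]
  exact integral_add h1 h2

lemma cv_sub_left {f g h : ℝ → ℝ} (hf : Integrable f) (hg : Integrable g) (hh : Integrable h) :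
    ∀ᵐ x, cv (fun s => f s - g s) h x = cv f h x - cv g h x := by
  filter_upwards [cv_ae hf hh, cv_ae hg hh] with x h1 h2
  simp only [cv, sub_mul]
  exact integral_sub h1 h2

lemma cv_const_right (c : ℝ) (f g : ℝ → ℝ) (x : ℝ) :
    cv f (fun s => c * g s) x = c * cv f g x := by
  simp only [cv]
  rw [← integral_const_mul]
  congr 1; funext s; ring

lemma cv_const_left (c : ℝ) (f g : ℝ → ℝ) (x : ℝ) :
    cv (fun s => c * f s) g x = c * cv f g x := by
  simp only [cv]
  rw [← integral_const_mul]
  congr 1; funext s; ring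

lemma cv_mono_right {f g h : ℝ → ℝ} (hf : Integrable f) (hg : Integrable g) (hh : Integrable h)
    (hf0 : ∀ᵐ x, 0 ≤ f x) (hgh : ∀ᵐ x, g x ≤ h x) :
    ∀ᵐ x, cv f g x ≤ cv f h x := by
  filter_upwards [cv_ae hf hg, cv_ae hf hh] with x h1 h2
  apply integral_mono_ae h1 h2
  have h3 : ∀ᵐ s, 0 ≤ f (x - s) :=
    (quasiMeasurePreserving_sub_left volume x).ae hf0
  filter_upwards [h3, hgh] with s h3 h4
  exact mul_le_mul_of_nonneg_left h4 h3

lemma bmul_int {b g : ℝ → ℝ} {c : ℝ} (hb : Measurable b) (hbc : ∀ x, |b x| ≤ c)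
    (hg : Integrable g) : Integrable (fun s => b s * g s) :=
  hg.bdd_mul hb.aestronglyMeasurable (Eventually.of_forall hbc)

lemma bmul_norm {b g : ℝ → ℝ} {c : ℝ} (hb : Measurable b) (hbc : ∀ x, |b x| ≤ c)
    (hg : Integrable g) : ∫ s, |b s * g s| ≤ c * ∫ s, |g s| := by
  rw [← integral_const_mul]
  refine integral_mono (bmul_int hb hbc hg).abs (hg.abs.const_mul c) fun s => ?_
  simp only [abs_mul]
  exact mul_le_mul_of_nonneg_right (hbc s) (abs_nonneg _)

lemma zero_of_le {F d : ℝ → ℝ} {c : ℝ} (hF : Integrable F) (hd : Integrable d)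
    (hc : c * ∫ x, F x < 1) (h : ∀ᵐ x, |d x| ≤ cv F (fun s => c * |d s|) x) :
    ∀ᵐ x, d x = 0 := by
  have h1 : ∫ x, |d x| ≤ (∫ x, F x) * (c * ∫ x, |d x|) := by
    rw [← integral_const_mul, ← cv_integral hF (hd.abs.const_mul c)]
    exact integral_mono_ae hd.abs (cv_int hF (hd.abs.const_mul c)) h
  have h0 : 0 ≤ ∫ x, |d x| := integral_nonneg fun x => abs_nonneg _
  have h2 : ∫ x, |d x| = 0 := by nlinarith
  rw [integral_eq_zero_iff_of_nonneg (fun x => abs_nonneg _) hd.abs] at h2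
  filter_upwards [h2] with x hx
  simpa using hx

lemma exists_sol {K b g : ℝ → ℝ} {c : ℝ} (hK : Integrable K) (hb : Measurable b)
    (hbc : ∀ x, |b x| ≤ c) (hc : c * ∫ x, |K x| < 1) (hg : Integrable g) :
    ∃ Y : ℝ → ℝ, Integrable Y ∧ ∀ᵐ x, Y x = g x + cv K (fun s => b s * Y s) x := by
  have hc0 : 0 ≤ c := (abs_nonneg _).trans (hbc 0)
  have hI : ∀ f : Lp ℝ 1 (volume : Measure ℝ), Integrable (f : ℝ → ℝ) := L1.integrable_coeFn
  have hJ : ∀ f : Lp ℝ 1 (volume : Measure ℝ),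
      Integrable (fun x => g x + cv K (fun s => b s * f s) x) := fun f =>
    hg.add (cv_int hK (bmul_int hb hbc (hI f)))
  let Φ : Lp ℝ 1 (volume : Measure ℝ) → Lp ℝ 1 (volume : Measure ℝ) := fun f => (hJ f).toL1 _
  have hK0 : 0 ≤ ∫ x, |K x| := integral_nonneg fun x => abs_nonneg _
  let q : NNReal := ⟨c * ∫ x, |K x|, mul_nonneg hc0 hK0⟩
  have hq : ContractingWith q Φ := by
    refine ⟨by exact_mod_cast hc, LipschitzWith.of_dist_le_mul fun f f' => ?_⟩
    rw [dist_eq_norm, dist_eq_norm]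
    simp only [Φ]
    rw [← Integrable.toL1_sub, L1.norm_of_fun_eq_integral_norm, L1.norm_eq_integral_norm]
    have h1 : ∫ a, ‖((f - f' : Lp ℝ 1 (volume : Measure ℝ)) : ℝ → ℝ) a‖ = ∫ a, |f a - f' a| := by
      apply integral_congr_ae
      filter_upwards [Lp.coeFn_sub f f'] with x hx
      rw [hx]; rfl
    rw [h1]
    have hd : Integrable (fun a => f a - f' a) := (hI f).sub (hI f')
    calc _ = ∫ a, |cv K (fun s => b s * (f s - f' s)) a| := by
          apply integral_congr_ae
          filter_upwards [cv_sub_right hK (bmul_int hb hbc (hI f)) (bmul_int hb hbc (hI f'))]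
            with x hx
          have : (fun s => b s * (f s - f' s)) = fun s => b s * f s - b s * f' s := by
            funext s; ring
          rw [this, hx]
          simp
      _ ≤ (∫ x, |K x|) * ∫ x, |b x * (f x - f' x)| := cv_norm hK (bmul_int hb hbc hd)
      _ ≤ (∫ x, |K x|) * (c * ∫ x, |f x - f' x|) :=
          mul_le_mul_of_nonneg_left (bmul_norm hb hbc hd) hK0
      _ = (c * ∫ x, |K x|) * ∫ x, |f x - f' x| := by ring
  refine ⟨((ContractingWith.fixedPoint Φ hq : Lp ℝ 1 (volume : Measure ℝ)) : ℝ → ℝ), hI _, ?_⟩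
  have hfix := hq.fixedPoint_isFixedPt
  have h2 := Integrable.coeFn_toL1 (hJ (ContractingWith.fixedPoint Φ hq))
  have h3 : Φ (ContractingWith.fixedPoint Φ hq) = ContractingWith.fixedPoint Φ hq := hfix
  filter_upwards [h2] with x hx
  rw [← hx]
  exact congrArg (fun f : Lp ℝ 1 (volume : Measure ℝ) => f x) h3.symm

/-- the regularized, exponentially weighted kernel -/
def Ke (γ l ε : ℝ) : ℝ → ℝ :=
  (Ici (0:ℝ)).indicator (fun t => (t + ε) ^ (γ - 1) * exp (-(l * t)))

lemma Ke_of_nonneg {γ l ε t : ℝ} (ht : 0 ≤ t) :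
    Ke γ l ε t = (t + ε) ^ (γ - 1) * exp (-(l * t)) := by
  simp [Ke, ht]

lemma Ke_of_neg {γ l ε t : ℝ} (ht : t < 0) : Ke γ l ε t = 0 := by
  simp [Ke, ht]

lemma Ke_nonneg {γ l ε : ℝ} (hε : 0 ≤ ε) (t : ℝ) : 0 ≤ Ke γ l ε t := by
  apply indicator_nonneg
  intro x hx
  have : 0 ≤ x + ε := add_nonneg hx hε
  positivity

lemma Ke_meas (γ l ε : ℝ) : Measurable (Ke γ l ε) := by
  apply Measurable.indicator _ measurableSet_Ici
  fun_prop

lemma Ke_zero {γ l : ℝ} (hγ : γ < 1) : Ke γ l 0 0 = 0 := by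
  rw [Ke_of_nonneg le_rfl, add_zero, zero_rpow (by linarith)]
  simp

lemma Ke_eq_ind {γ l : ℝ} (hγ : γ < 1) :
    Ke γ l 0 = (Ioi (0:ℝ)).indicator (fun t => t ^ (γ - 1) * exp (-(l * t))) := by
  funext t
  rcases lt_trichotomy t 0 with h | h | h
  · rw [Ke_of_neg h]; simp [h.le]
  · subst h; rw [Ke_zero hγ]; simp
  · rw [Ke_of_nonneg h.le]; simp [h]

lemma Ke0_int {γ l : ℝ} (h0 : 0 < γ) (hγ : γ < 1) (hl : 0 < l) : Integrable (Ke γ l 0) := by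
  rw [Ke_eq_ind hγ, integrable_indicator_iff measurableSet_Ioi]
  have := integrableOn_rpow_mul_exp_neg_mul_rpow (p := 1) (s := γ - 1) (b := l)
    (by linarith) one_pos hl
  simpa using this

lemma Ke0_integral {γ l : ℝ} (h0 : 0 < γ) (hγ : γ < 1) (hl : 0 < l) :
    ∫ t, Ke γ l 0 t = (1 / l) ^ γ * Gamma γ := by
  rw [Ke_eq_ind hγ, integral_indicator measurableSet_Ioi]
  exact Real.integral_rpow_mul_exp_neg_mul_Ioi h0 hl

lemma Ke_le {γ l ε : ℝ} (hγ : γ < 1) (hε : 0 ≤ ε) {t : ℝ} (ht : t ≠ 0) :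
    Ke γ l ε t ≤ Ke γ l 0 t := by
  rcases lt_or_gt_of_ne ht with h | h
  · rw [Ke_of_neg h, Ke_of_neg h]
  · rw [Ke_of_nonneg h.le, Ke_of_nonneg h.le]
    refine mul_le_mul_of_nonneg_right ?_ (exp_pos _).le
    exact rpow_le_rpow_of_nonpos (by linarith) (by linarith) (by linarith)

lemma Ke_le_ae {γ l ε : ℝ} (hγ : γ < 1) (hε : 0 ≤ ε) :
    ∀ᵐ t, Ke γ l ε t ≤ Ke γ l 0 t := by
  have : ∀ᵐ t : ℝ, t ≠ 0 := by simp [ae_iff]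
  filter_upwards [this] with t ht using Ke_le hγ hε ht

lemma Ke_int {γ l ε : ℝ} (h0 : 0 < γ) (hγ : γ < 1) (hl : 0 < l) (hε : 0 ≤ ε) :
    Integrable (Ke γ l ε) := by
  refine (Ke0_int h0 hγ hl).mono' (Ke_meas γ l ε).aestronglyMeasurable ?_
  filter_upwards [Ke_le_ae (l := l) hγ hε] with t ht
  rw [norm_eq_abs, abs_of_nonneg (Ke_nonneg hε t)]
  exact ht

lemma Ke_anti {γ l ε : ℝ} (hγ : γ < 1) (hl : 0 < l) (hε : 0 ≤ ε) {s t : ℝ} (hs : 0 < s + ε)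
    (hs0 : 0 ≤ s) (hst : s ≤ t) : Ke γ l ε t ≤ Ke γ l ε s := by
  rw [Ke_of_nonneg hs0, Ke_of_nonneg (hs0.trans hst)]
  refine mul_le_mul ?_ ?_ (exp_pos _).le (by positivity)
  · exact rpow_le_rpow_of_nonpos hs (by linarith) (by linarith)
  · apply exp_le_exp.2
    nlinarith

lemma Ke_le_zero {γ l ε : ℝ} (hγ : γ < 1) (hl : 0 < l) (hε : 0 < ε) (t : ℝ) :
    Ke γ l ε t ≤ Ke γ l ε 0 := by
  rcases lt_or_ge t 0 with h | h
  · rw [Ke_of_neg h]; exact Ke_nonneg hε.le 0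
  · exact Ke_anti hγ hl hε.le (by linarith) le_rfl h

lemma Ke_pos {γ l ε : ℝ} {t : ℝ} (ht : 0 ≤ t) (h : 0 < t + ε) : 0 < Ke γ l ε t := by
  rw [Ke_of_nonneg ht]; positivity

/-- log-convexity -/
lemma Ke_key {γ l ε : ℝ} (hγ : γ < 1) (hε : 0 < ε) {s t u : ℝ} (hs : 0 ≤ s)
    (hst : s ≤ t) (htu : t ≤ u) :
    Ke γ l ε t * Ke γ l ε (u - s) ≤ Ke γ l ε u * Ke γ l ε (t - s) := by
  rw [Ke_of_nonneg (by linarith : 0 ≤ t), Ke_of_nonneg (by linarith : 0 ≤ u - s),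
    Ke_of_nonneg (by linarith : 0 ≤ u), Ke_of_nonneg (by linarith : 0 ≤ t - s)]
  have e : exp (-(l * t)) * exp (-(l * (u - s))) = exp (-(l * u)) * exp (-(l * (t - s))) := by
    rw [← exp_add, ← exp_add]; congr 1; ring
  have p : (t + ε) ^ (γ - 1) * (u - s + ε) ^ (γ - 1) ≤
      (u + ε) ^ (γ - 1) * (t - s + ε) ^ (γ - 1) := by
    rw [← mul_rpow (by linarith) (by linarith), ← mul_rpow (by linarith) (by linarith)]
    refine rpow_le_rpow_of_nonpos ?_ ?_ (by linarith)
    · have h1 : 0 < u + ε := by linarith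
      have h2 : 0 < t - s + ε := by linarith
      positivity
    · nlinarith
  calc _ = ((t + ε) ^ (γ - 1) * (u - s + ε) ^ (γ - 1)) *
        (exp (-(l * t)) * exp (-(l * (u - s)))) := by ring
    _ ≤ ((u + ε) ^ (γ - 1) * (t - s + ε) ^ (γ - 1)) *
        (exp (-(l * t)) * exp (-(l * (u - s)))) :=
        mul_le_mul_of_nonneg_right p (by positivity)
    _ = _ := by rw [e]; ring

lemma Ke_contAt {γ l ε : ℝ} (hε : 0 < ε) {x : ℝ} (hx : x ≠ 0) : ContinuousAt (Ke γ l ε) x := by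
  rcases lt_or_gt_of_ne hx with h | h
  · have : Ke γ l ε =ᶠ[𝓝 x] fun _ => 0 := by
      filter_upwards [Iio_mem_nhds h] with y hy using Ke_of_neg hy
    exact continuousAt_const.congr this.symm
  · have : Ke γ l ε =ᶠ[𝓝 x] fun t => (t + ε) ^ (γ - 1) * exp (-(l * t)) := by
      filter_upwards [Ioi_mem_nhds h] with y hy using Ke_of_nonneg (le_of_lt hy)
    refine ContinuousAt.congr ?_ this.symm
    refine ContinuousAt.mul (ContinuousAt.rpow_const (by fun_prop) (Or.inl (by linarith)))
      (by fun_prop)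

lemma Ke_contOn {γ l ε : ℝ} (hε : 0 < ε) : ContinuousOn (Ke γ l ε) (Ici 0) := by
  have : ContinuousOn (fun t => (t + ε) ^ (γ - 1) * exp (-(l * t))) (Ici 0) := by
    refine ContinuousOn.mul (ContinuousOn.rpow_const (by fun_prop) ?_) (by fun_prop)
    intro x hx
    left
    have : 0 ≤ x := hx
    linarith
  exact this.congr fun x hx => Ke_of_nonneg hx

lemma Ke_prod_int {γ l ε : ℝ} (hγ : γ < 1) (hl : 0 < l) (hε : 0 < ε) {g : ℝ → ℝ}
    (hg : Integrable g) (t : ℝ) : Integrable (fun s => Ke γ l ε (t - s) * g s) := by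
  refine hg.bdd_mul (c := Ke γ l ε 0) ?_ (Eventually.of_forall fun s => ?_)
  · exact ((Ke_meas γ l ε).comp (by fun_prop)).aestronglyMeasurable
  · rw [norm_eq_abs, abs_of_nonneg (Ke_nonneg hε.le _)]
    exact Ke_le_zero hγ hl hε _

lemma cv_Ke_cont {γ l ε : ℝ} (hγ : γ < 1) (hl : 0 < l) (hε : 0 < ε) {g : ℝ → ℝ}
    (hg : Integrable g) : Continuous (cv (Ke γ l ε) g) := by
  rw [continuous_iff_continuousAt]
  intro t
  refine continuousAt_of_dominated (bound := fun s => Ke γ l ε 0 * |g s|) ?_ ?_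
    (hg.abs.const_mul _) ?_
  · exact Eventually.of_forall fun x => (Ke_prod_int hγ hl hε hg x).aestronglyMeasurable
  · refine Eventually.of_forall fun x => Eventually.of_forall fun s => ?_
    rw [norm_mul, norm_eq_abs, abs_of_nonneg (Ke_nonneg hε.le _)]
    exact mul_le_mul_of_nonneg_right (Ke_le_zero hγ hl hε _) (abs_nonneg _)
  · have : ∀ᵐ s : ℝ, s ≠ t := by simp [ae_iff]
    filter_upwards [this] with s hs
    have h1 : ContinuousAt (Ke γ l ε) (t - s) := Ke_contAt hε (sub_ne_zero.2 hs.symm)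
    have h2 : ContinuousAt (fun x => Ke γ l ε (x - s)) t :=
      ContinuousAt.comp (g := Ke γ l ε) (f := fun x => x - s) h1 (by fun_prop)
    exact h2.mul continuousAt_const

/-- cut-off constant -/
def cut (N : ℝ) : ℝ → ℝ := (Ioi (0:ℝ)).indicator (fun _ => N)

lemma cut_meas (N : ℝ) : Measurable (cut N) := measurable_const.indicator measurableSet_Ioi

lemma cut_le {N : ℝ} (hN : 0 ≤ N) (x : ℝ) : |cut N x| ≤ N := by
  by_cases h : x ∈ Ioi (0:ℝ) <;> simp [cut, h, abs_of_nonneg hN, hN]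

lemma cv_cut_nonpos {γ l ε N : ℝ} (g : ℝ → ℝ) {t : ℝ} (ht : t ≤ 0) :
    cv (Ke γ l ε) (fun s => cut N s * g s) t = 0 := by
  simp only [cv]
  rw [← integral_zero ℝ ℝ]
  congr 1
  funext s
  by_cases h : 0 < s
  · rw [Ke_of_neg (by linarith)]; simp
  · have : cut N s = 0 := by simp [cut, not_lt.1 h]
    simp [this]

lemma res_eps {γ l ε N : ℝ} (h0 : 0 < γ) (hγ : γ < 1) (hl : 0 < l) (hε : 0 < ε) (hN : 0 < N)
    (hc : N * ∫ x, |Ke γ l ε x| < 1) :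
    ∃ R : ℝ → ℝ, Integrable R ∧ (∀ t, 0 ≤ R t) ∧
      ∀ t, R t = Ke γ l ε t - cv (Ke γ l ε) (fun s => cut N s * R s) t := by
  have hK := Ke_int h0 hγ hl hε.le
  obtain ⟨R0, hR0, hR0e⟩ := exists_sol (b := fun s => - cut N s) (c := N) hK (cut_meas N).neg
    (fun x => by rw [abs_neg]; exact cut_le hN.le x) hc hK
  have hbR0 : Integrable (fun s => cut N s * R0 s) := bmul_int (cut_meas N) (cut_le hN.le) hR0
  set R : ℝ → ℝ := fun t => Ke γ l ε t - cv (Ke γ l ε) (fun s => cut N s * R0 s) t with hRdef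
  have hRR0 : R =ᵐ[volume] R0 := by
    filter_upwards [hR0e] with x hx
    rw [hx, hRdef]
    simp [cv, integral_neg, sub_eq_add_neg]
  have hcv : cv (Ke γ l ε) (fun s => cut N s * R s) = cv (Ke γ l ε) (fun s => cut N s * R0 s) := by
    apply cv_congr (EventuallyEq.refl _ _)
    filter_upwards [hRR0] with x hx
    rw [hx]
  have hRi : Integrable R := hR0.congr hRR0.symm
  have hRe : ∀ t, R t = Ke γ l ε t - cv (Ke γ l ε) (fun s => cut N s * R s) t := by
    intro t; rw [hcv]
  have hbR : Integrable (fun s => cut N s * R s) := bmul_int (cut_meas N) (cut_le hN.le) hRi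
  refine ⟨R, hRi, ?_, hRe⟩
  have hcont : ContinuousOn R (Ici 0) :=
    (Ke_contOn hε).sub (cv_Ke_cont hγ hl hε hbR0).continuousOn
  clear_value R
  set k := Ke γ l ε with hk
  have hk0 : 0 < k 0 := Ke_pos le_rfl (by linarith)
  have hR00 : R 0 = k 0 := by rw [hRe, cv_cut_nonpos _ le_rfl, sub_zero]
  intro t1
  rcases lt_or_ge t1 0 with ht1 | ht1
  · rw [hRe, cv_cut_nonpos _ ht1.le, hk, Ke_of_neg ht1]; simp
  by_contra hneg
  push Not at hneg
  -- first zero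
  have hcl : IsCompact (Icc 0 t1 ∩ R ⁻¹' Iic 0) := by
    refine (isCompact_Icc (a := (0:ℝ)) (b := t1)).of_isClosed_subset ?_ inter_subset_left
    exact (hcont.mono Icc_subset_Ici_self).preimage_isClosed_of_isClosed isClosed_Icc isClosed_Iic
  obtain ⟨u, ⟨⟨hu0, hu1⟩, huR⟩, hmin⟩ := hcl.exists_isLeast ⟨t1, ⟨ht1, le_rfl⟩, hneg.le⟩
  have huR : R u ≤ 0 := huR
  have hpos : ∀ t, 0 ≤ t → t < u → 0 < R t := by
    intro t ht htu
    by_contra hcon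
    push Not at hcon
    exact absurd (hmin ⟨⟨ht, (htu.le.trans hu1)⟩, hcon⟩) (not_le.2 htu)
  have hu : 0 < u := by
    rcases hu0.eq_or_lt with h | h
    · rw [← h, hR00] at huR; linarith
    · exact h
  have hku : 0 < k u := Ke_pos hu0 (by linarith)
  set h := min u (k u / (2 * N * (k 0) ^ 2)) with hh
  have hhpos : 0 < h := lt_min hu (by positivity)
  have hhu : h ≤ u := min_le_left _ _
  have hh2 : N * (k 0) ^ 2 * h < k u := by
    have : h ≤ k u / (2 * N * (k 0) ^ 2) := min_le_right _ _
    rw [le_div_iff₀ (by positivity)] at this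
    nlinarith
  obtain ⟨t, ⟨hta, htb⟩, hmax⟩ := (isCompact_Icc (a := u - h) (b := u)).exists_isMaxOn
    ⟨u, by linarith, le_rfl⟩ (hcont.mono (fun x hx => by
      have := hx.1
      show (0:ℝ) ≤ x
      linarith))
  have hmax' : ∀ s, u - h ≤ s → s ≤ u → R s ≤ R t := fun s h1 h2 => hmax ⟨h1, h2⟩
  have hm : 0 < R t :=
    (hpos (u - h) (by linarith) (by linarith)).trans_le (hmax' _ le_rfl (by linarith))
  have htu : t < u := by
    rcases htb.eq_or_lt with h | h
    · rw [h] at hm; linarith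
    · exact h
  have ht0 : 0 ≤ t := by linarith
  have hkt : 0 < k t := Ke_pos ht0 (by linarith)
  have hkt0 : k t ≤ k 0 := Ke_le_zero hγ hl hε t
  have main : k t * cv k (fun s => cut N s * R s) u ≤
      k u * cv k (fun s => cut N s * R s) t + k t * k 0 * N * R t * (u - t) := by
    have i1 : Integrable ((Icc t u).indicator (fun _ => k t * k 0 * N * R t)) := by
      rw [integrable_indicator_iff measurableSet_Icc]
      exact integrableOn_const (by simp)
    have i2 : ∫ s, (Icc t u).indicator (fun _ => k t * k 0 * N * R t) s =
        k t * k 0 * N * R t * (u - t) := by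
      rw [integral_indicator measurableSet_Icc, setIntegral_const]
      simp [htu.le]; ring
    rw [← i2]
    simp only [cv]
    rw [← integral_const_mul, ← integral_const_mul, ← integral_add
      ((Ke_prod_int hγ hl hε hbR t).const_mul _) i1]
    refine integral_mono ((Ke_prod_int hγ hl hε hbR u).const_mul _)
      (((Ke_prod_int hγ hl hε hbR t).const_mul _).add i1) fun s => ?_
    change k t * (k (u - s) * (cut N s * R s)) ≤ k u * (k (t - s) * (cut N s * R s)) +
      (Icc t u).indicator (fun _ => k t * k 0 * N * R t) s
    have hks : ∀ x, 0 ≤ k x := Ke_nonneg hε.le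
    rcases le_or_gt s 0 with hs | hs
    · have : cut N s = 0 := by simp [cut, hs]
      rw [this]
      simp only [zero_mul, mul_zero, zero_add]
      apply indicator_nonneg
      intro x hx
      have := hks 0
      positivity
    have hcs : cut N s = N := by simp [cut, hs]
    rw [hcs]
    rcases lt_or_ge s t with hst | hst
    · have hns : s ∉ Icc t u := fun h => absurd h.1 (not_le.2 hst)
      rw [indicator_of_notMem hns, add_zero]
      have key := Ke_key (l := l) hγ hε hs.le hst.le htu.le
      have := hpos s hs.le (hst.trans htu)
      calc _ = (k t * k (u - s)) * (N * R s) := by ring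
        _ ≤ (k u * k (t - s)) * (N * R s) := mul_le_mul_of_nonneg_right key (by positivity)
        _ = _ := by ring
    rcases le_or_gt s u with hsu | hsu
    · have hns : s ∈ Icc t u := ⟨hst, hsu⟩
      rw [indicator_of_mem hns]
      have hm1 := hmax' s (by linarith) hsu
      have hk1 : k (u - s) ≤ k 0 := Ke_le_zero hγ hl hε _
      have e1 : k (u - s) * R s ≤ k 0 * R t :=
        (mul_le_mul_of_nonneg_left hm1 (hks _)).trans (mul_le_mul_of_nonneg_right hk1 hm.le)
      have e2 : 0 ≤ k u * (k (t - s) * (N * R s)) := by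
        rcases hst.eq_or_lt with h | h
        · have : 0 ≤ k (t - s) := hks _
          rw [← h] at this ⊢
          positivity
        · have : k (t - s) = 0 := Ke_of_neg (by linarith)
          rw [this]; simp
      have e3 := mul_le_mul_of_nonneg_left e1 (by positivity : 0 ≤ k t * N)
      linarith
    · have hns : s ∉ Icc t u := fun h => absurd h.2 (not_le.2 hsu)
      have a1 : k (u - s) = 0 := Ke_of_neg (by linarith)
      have a2 : k (t - s) = 0 := Ke_of_neg (by linarith)
      rw [indicator_of_notMem hns, a1, a2]
      simp
  have e1 := hRe u
  have e2 := hRe t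
  have e3 : k t * R u ≥ k u * R t - N * (k t * k 0 * R t * (u - t)) := by
    rw [e1]
    nlinarith
  have e4 : k t * k 0 * (u - t) ≤ (k 0) ^ 2 * h := by
    have : k t * k 0 ≤ (k 0) ^ 2 := by nlinarith
    have h3 : u - t ≤ h := by linarith
    exact mul_le_mul this h3 (by linarith) (by positivity)
  have e5 : N * (k t * k 0 * R t * (u - t)) ≤ (N * (k 0) ^ 2 * h) * R t := by
    have := mul_le_mul_of_nonneg_left e4 (by positivity : 0 ≤ N * R t)
    linarith
  have e6 : (N * (k 0) ^ 2 * h) * R t < k u * R t := mul_lt_mul_of_pos_right hh2 hm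
  have e7 : k t * R u ≤ 0 := mul_nonpos_of_nonneg_of_nonpos hkt.le huR
  linarith

lemma Ke_tendsto {γ l : ℝ} (h0 : 0 < γ) (hγ : γ < 1) (hl : 0 < l) :
    Tendsto (fun n : ℕ => ∫ t, |Ke γ l (1 / ((n:ℝ) + 1)) t - Ke γ l 0 t|) atTop (𝓝 0) := by
  have hK0 := Ke0_int h0 hγ hl
  have hpos : ∀ n : ℕ, (0:ℝ) ≤ 1 / ((n:ℝ) + 1) := fun n => by positivity
  have := tendsto_integral_of_dominated_convergence (μ := volume)
    (F := fun (n : ℕ) t => |Ke γ l (1 / ((n:ℝ) + 1)) t - Ke γ l 0 t|) (f := fun _ => (0:ℝ))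
    (fun t => Ke γ l 0 t)
    (fun n => ((Ke_int h0 hγ hl (hpos n)).sub hK0).abs.aestronglyMeasurable) hK0
    (fun n => ?_) ?_
  · simpa using this
  · filter_upwards [Ke_le_ae (l := l) hγ (hpos n)] with t ht
    have h1 := Ke_nonneg (γ := γ) (l := l) (hpos n) t
    rw [norm_eq_abs, abs_abs, abs_le]
    constructor <;> linarith
  · have : ∀ᵐ t : ℝ, t ≠ 0 := by simp [ae_iff]
    filter_upwards [this] with t ht
    rcases lt_or_gt_of_ne ht with h | h
    · simp [Ke_of_neg h]
    · simp only [Ke_of_nonneg h.le]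
      have h1 : Tendsto (fun n : ℕ => t + 1 / ((n:ℝ) + 1)) atTop (𝓝 (t + 0)) :=
        tendsto_const_nhds.add tendsto_one_div_add_atTop_nhds_zero_nat
      have h2 : Tendsto (fun n : ℕ => (t + 1 / ((n:ℝ) + 1)) ^ (γ - 1)) atTop
          (𝓝 ((t + 0) ^ (γ - 1))) := h1.rpow_const (Or.inl (by linarith))
      have h3 := ((h2.mul_const (exp (-(l * t)))).sub_const ((t + 0) ^ (γ - 1) * exp (-(l * t)))).abs
      simpa using h3

lemma res_nonneg {γ l N : ℝ} (h0 : 0 < γ) (hγ : γ < 1) (hl : 0 < l) (hN : 0 < N)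
    (hc : N * ∫ x, Ke γ l 0 x ≤ 1 / 2) {R : ℝ → ℝ} (hR : Integrable R)
    (hRe : ∀ᵐ t, R t = Ke γ l 0 t - cv (Ke γ l 0) (fun s => cut N s * R s) t) :
    ∀ᵐ t, 0 ≤ R t := by
  have hK := Ke0_int h0 hγ hl
  set A := ∫ t, |R t| with hA
  have hA0 : 0 ≤ A := integral_nonneg fun x => abs_nonneg _
  set κ := ∫ x, Ke γ l 0 x with hκ
  have hbR : Integrable (fun s => cut N s * R s) := bmul_int (cut_meas N) (cut_le hN.le) hR
  have bound : ∀ ε : ℝ, 0 < ε → ∫ t, max (- R t) 0 ≤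
      2 * (1 + N * A) * ∫ t, |Ke γ l ε t - Ke γ l 0 t| := by
    intro ε hε
    have hKe := Ke_int h0 hγ hl hε.le
    have hle : ∫ x, |Ke γ l ε x| ≤ κ := by
      refine integral_mono_ae hKe.abs hK ?_
      filter_upwards [Ke_le_ae (l := l) hγ hε.le] with t ht
      rw [abs_of_nonneg (Ke_nonneg hε.le t)]
      exact ht
    obtain ⟨S, hS, hS0, hSe⟩ := res_eps h0 hγ hl hε hN (by nlinarith)
    have hbS : Integrable (fun s => cut N s * S s) := bmul_int (cut_meas N) (cut_le hN.le) hS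
    have hD : Integrable (fun s => S s - R s) := hS.sub hR
    have hbD : Integrable (fun s => cut N s * (S s - R s)) :=
      bmul_int (cut_meas N) (cut_le hN.le) hD
    have hKd : Integrable (fun t => Ke γ l ε t - Ke γ l 0 t) := hKe.sub hK
    set δ := ∫ t, |Ke γ l ε t - Ke γ l 0 t| with hδ
    have hδ0 : 0 ≤ δ := integral_nonneg fun x => abs_nonneg _
    set d := ∫ t, |S t - R t| with hd
    have hd0 : 0 ≤ d := integral_nonneg fun x => abs_nonneg _
    have e : ∀ᵐ t, |S t - R t| ≤ |Ke γ l ε t - Ke γ l 0 t| +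
        |cv (Ke γ l ε) (fun s => cut N s * (S s - R s)) t| +
        |cv (fun t => Ke γ l ε t - Ke γ l 0 t) (fun s => cut N s * R s) t| := by
      filter_upwards [hRe, cv_sub_right hKe hbS hbR, cv_sub_left hKe hK hbR] with t h1 h2 h3
      have h4 : (fun s => cut N s * (S s - R s)) = fun s => cut N s * S s - cut N s * R s := by
        funext s; ring
      have h5 : S t - R t = (Ke γ l ε t - Ke γ l 0 t) -
          cv (Ke γ l ε) (fun s => cut N s * (S s - R s)) t -
          cv (fun t => Ke γ l ε t - Ke γ l 0 t) (fun s => cut N s * R s) t := by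
        rw [hSe t, h1, h4, h2, h3]; ring
      rw [h5]
      exact (abs_sub _ _).trans (add_le_add_left (abs_sub _ _) _)
    have f1 : d ≤ δ + κ * (N * d) + δ * (N * A) := by
      have g1 := integral_mono_ae hD.abs ((hKd.abs.add (cv_int hKe hbD).abs).add
        (cv_int hKd hbR).abs) e
      have g2 : ∫ t, (|Ke γ l ε t - Ke γ l 0 t| +
        |cv (Ke γ l ε) (fun s => cut N s * (S s - R s)) t| +
        |cv (fun t => Ke γ l ε t - Ke γ l 0 t) (fun s => cut N s * R s) t|) =
        δ + (∫ t, |cv (Ke γ l ε) (fun s => cut N s * (S s - R s)) t|) +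
        ∫ t, |cv (fun t => Ke γ l ε t - Ke γ l 0 t) (fun s => cut N s * R s) t| := by
        have i1 : Integrable (fun t => |Ke γ l ε t - Ke γ l 0 t| +
            |cv (Ke γ l ε) (fun s => cut N s * (S s - R s)) t|) :=
          hKd.abs.add (cv_int hKe hbD).abs
        rw [integral_add i1 (cv_int hKd hbR).abs,
          integral_add hKd.abs (cv_int hKe hbD).abs]
      have g3 : ∫ t, |cv (Ke γ l ε) (fun s => cut N s * (S s - R s)) t| ≤ κ * (N * d) :=
        (cv_norm hKe hbD).trans (mul_le_mul hle (bmul_norm (cut_meas N) (cut_le hN.le) hD)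
          (integral_nonneg fun x => abs_nonneg _) (integral_nonneg fun x => Ke_nonneg le_rfl x))
      have g4 : ∫ t, |cv (fun t => Ke γ l ε t - Ke γ l 0 t) (fun s => cut N s * R s) t| ≤
          δ * (N * A) :=
        (cv_norm hKd hbR).trans (mul_le_mul_of_nonneg_left
          (bmul_norm (cut_meas N) (cut_le hN.le) hR) hδ0)
      have g1' : d ≤ ∫ t, (|Ke γ l ε t - Ke γ l 0 t| +
        |cv (Ke γ l ε) (fun s => cut N s * (S s - R s)) t| +
        |cv (fun t => Ke γ l ε t - Ke γ l 0 t) (fun s => cut N s * R s) t|) := g1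
      rw [g2] at g1'
      linarith
    have f2 : d ≤ 2 * (1 + N * A) * δ := by nlinarith
    refine le_trans ?_ f2
    refine integral_mono hR.neg.pos_part hD.abs fun t => ?_
    have := hS0 t
    refine max_le ?_ (abs_nonneg _)
    exact le_trans (by simp only; linarith) (le_abs_self _)
  have hlim : Tendsto (fun n : ℕ => 2 * (1 + N * A) *
      ∫ t, |Ke γ l (1 / ((n:ℝ) + 1)) t - Ke γ l 0 t|) atTop (𝓝 (2 * (1 + N * A) * 0)) :=
    (Ke_tendsto h0 hγ hl).const_mul _
  have hz : ∫ t, max (- R t) 0 ≤ 0 := by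
    have := ge_of_tendsto' hlim (fun n => bound (1 / ((n:ℝ) + 1)) (by positivity))
    simpa using this
  have hz' : ∫ t, max (- R t) 0 = 0 :=
    le_antisymm hz (integral_nonneg fun t => le_max_right _ _)
  have i1 : Integrable (fun t => max (- R t) 0) := hR.neg.pos_part
  rw [integral_eq_zero_iff_of_nonneg (f := fun t => max (- R t) 0)
    (fun t => le_max_right _ _) i1] at hz'
  filter_upwards [hz'] with t ht
  have h1 : max (- R t) 0 = 0 := ht
  have := le_max_left (- R t) 0
  linarith

lemma KK_le {γ l : ℝ} (h0 : 0 < γ) (hγ : γ < 1) (hl : 0 < l) {t : ℝ} (ht : 0 < t)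
    (hI : Integrable (fun s => Ke γ l 0 (t - s) * Ke γ l 0 s)) :
    cv (Ke γ l 0) (Ke γ l 0) t ≤ 4 * exp (l * t / 2) * (∫ x, Ke γ l 0 x) * Ke γ l 0 t := by
  have hK := Ke0_int h0 hγ hl
  set k := Ke γ l 0 with hk
  have hk0 : ∀ x, 0 ≤ k x := Ke_nonneg le_rfl
  have hz : ∀ x, x ≤ 0 → k x = 0 := by
    intro x hx
    rcases hx.eq_or_lt with h | h
    · rw [h]; exact Ke_zero hγ
    · exact Ke_of_neg h
  have hKt : Integrable (fun s => k (t - s)) := hK.comp_sub_left t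
  have h1 : cv k k t ≤ ∫ s, k (t / 2) * (k (t - s) + k s) := by
    refine integral_mono hI ((hKt.add hK).const_mul _) fun s => ?_
    change k (t - s) * k s ≤ k (t / 2) * (k (t - s) + k s)
    have p1 := hk0 (t / 2)
    have p2 := hk0 (t - s)
    have p3 := hk0 s
    rcases le_or_gt s (t / 2) with h | h
    · have : k (t - s) ≤ k (t / 2) :=
        Ke_anti hγ hl le_rfl (by linarith) (by linarith) (by linarith)
      nlinarith
    · have : k s ≤ k (t / 2) :=
        Ke_anti hγ hl le_rfl (by linarith) (by linarith) (by linarith)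
      nlinarith
  have h2 : ∫ s, k (t / 2) * (k (t - s) + k s) = k (t / 2) * (2 * ∫ x, k x) := by
    rw [integral_const_mul, integral_add hKt hK, integral_sub_left_eq_self]
    ring
  have h3 : k (t / 2) ≤ 2 * exp (l * t / 2) * k t := by
    rw [hk, Ke_of_nonneg (by linarith), Ke_of_nonneg ht.le, add_zero, add_zero]
    have e1 : exp (-(l * (t / 2))) = exp (l * t / 2) * exp (-(l * t)) := by
      rw [← exp_add]; congr 1; ring
    have e2 : (t / 2) ^ (γ - 1) ≤ 2 * t ^ (γ - 1) := by
      rw [div_rpow ht.le (by norm_num), div_eq_mul_inv, ← rpow_neg (by norm_num), mul_comm]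
      refine mul_le_mul_of_nonneg_right ?_ (by positivity)
      calc (2:ℝ) ^ (-(γ - 1)) ≤ 2 ^ (1:ℝ) :=
            rpow_le_rpow_of_exponent_le (by norm_num) (by linarith)
        _ = 2 := rpow_one 2
    rw [e1]
    have := mul_le_mul_of_nonneg_right e2 (by positivity : 0 ≤ exp (l * t / 2) * exp (-(l * t)))
    linarith
  have hκ : 0 ≤ ∫ x, k x := integral_nonneg hk0
  calc _ ≤ k (t / 2) * (2 * ∫ x, k x) := h1.trans_eq h2
    _ ≤ (2 * exp (l * t / 2) * k t) * (2 * ∫ x, k x) :=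
        mul_le_mul_of_nonneg_right h3 (by positivity)
    _ = _ := by ring

lemma res {γ l N : ℝ} (h0 : 0 < γ) (hγ : γ < 1) (hl : 0 < l) (hN : 0 < N)
    (hc : N * ∫ x, Ke γ l 0 x ≤ 1 / 16) :
    ∃ R : ℝ → ℝ, Integrable R ∧ (∀ᵐ t, 0 ≤ R t) ∧ (∀ᵐ t, R t ≤ Ke γ l 0 t) ∧
      (∀ᵐ t, R t + N * cv (Ke γ l 0) R t = Ke γ l 0 t) ∧
      ∃ δ > 0, ∀ᵐ t, t ∈ Ioo 0 δ → 0 < R t := by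
  have hK := Ke0_int h0 hγ hl
  have habs : (fun x => |Ke γ l 0 x|) = Ke γ l 0 := by
    funext x; exact abs_of_nonneg (Ke_nonneg le_rfl x)
  obtain ⟨R, hR, hRe⟩ := exists_sol (b := fun s => - cut N s) (c := N) hK (cut_meas N).neg
    (fun x => by rw [abs_neg]; exact cut_le hN.le x) (by rw [habs]; linarith) hK
  have hRe1 : ∀ᵐ t, R t = Ke γ l 0 t - cv (Ke γ l 0) (fun s => cut N s * R s) t := by
    filter_upwards [hRe] with t ht
    rw [ht]
    simp [cv, integral_neg, sub_eq_add_neg]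
  have hR0 := res_nonneg h0 hγ hl hN (by linarith) hR hRe1
  have hcut : (fun s => cut N s * R s) =ᵐ[volume] fun s => N * R s := by
    filter_upwards [hRe1] with t ht
    rcases le_or_gt t 0 with h | h
    · have : Ke γ l 0 t = 0 := by
        rcases h.eq_or_lt with h | h
        · rw [h]; exact Ke_zero hγ
        · exact Ke_of_neg h
      rw [ht, cv_cut_nonpos _ h, this]; simp
    · simp [cut, h]
  have hRe2 : ∀ᵐ t, R t + N * cv (Ke γ l 0) R t = Ke γ l 0 t := by
    filter_upwards [hRe1] with t ht
    rw [cv_congr (EventuallyEq.refl _ _) hcut, cv_const_right] at ht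
    linarith
  have hcv0 : ∀ᵐ t, 0 ≤ cv (Ke γ l 0) R t := by
    have := cv_mono_right (g := fun _ => 0) hK (integrable_zero _ _ _) hR
      (Eventually.of_forall (Ke_nonneg le_rfl)) hR0
    filter_upwards [this] with t ht
    simpa [cv] using ht
  have hRK : ∀ᵐ t, R t ≤ Ke γ l 0 t := by
    filter_upwards [hRe2, hcv0] with t h1 h2
    nlinarith
  refine ⟨R, hR, hR0, hRK, hRe2, log 2 / l, by positivity, ?_⟩
  filter_upwards [hRe2, cv_mono_right hK hR hK (Eventually.of_forall (Ke_nonneg le_rfl)) hRK,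
    cv_ae hK hK] with t h1 h2 h3 ht
  have h4 := KK_le h0 hγ hl ht.1 h3
  have h5 : exp (l * t / 2) ≤ 2 := by
    have : l * t < log 2 := by
      have := ht.2
      rw [lt_div_iff₀ hl] at this
      linarith
    have hp : 0 < l * t := mul_pos hl ht.1
    calc exp (l * t / 2) ≤ exp (log 2) := exp_le_exp.2 (by linarith)
      _ = 2 := exp_log (by norm_num)
  have hkp : 0 < Ke γ l 0 t := Ke_pos ht.1.le (by linarith [ht.1])
  have hκ : 0 ≤ ∫ x, Ke γ l 0 x := integral_nonneg (Ke_nonneg le_rfl)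
  set κ := ∫ x, Ke γ l 0 x
  set k := Ke γ l 0 t
  have h6 : 4 * exp (l * t / 2) * κ * k ≤ 4 * 2 * κ * k := by gcongr
  have h7 : N * cv (Ke γ l 0) R t ≤ N * (4 * 2 * κ * k) :=
    mul_le_mul_of_nonneg_left (h2.trans (h4.trans h6)) hN.le
  have h8 : N * (4 * 2 * κ * k) ≤ 1 / 2 * k := by nlinarith
  linarith

lemma sol {γ l M a : ℝ} {V : ℝ → ℝ} (h0 : 0 < γ) (hγ : γ < 1) (hl : 0 < l) (ha : 0 < a)
    (hV : Measurable V) (hVM : ∀ x, |V x| ≤ M)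
    (hc : (M + 1) * ∫ x, Ke γ l 0 x ≤ 1 / 16) :
    ∃ Y : ℝ → ℝ, Integrable Y ∧
      (∀ᵐ t, Y t + cv (Ke γ l 0) (fun s => V s * Y s) t = a * Ke γ l 0 t) ∧
      (∀ᵐ t, 0 < t → 0 < Y t) := by
  have hM : 0 ≤ M := (abs_nonneg _).trans (hVM 0)
  have hK := Ke0_int h0 hγ hl
  set N := M + 1 with hNdef
  have hN : 0 < N := by linarith
  obtain ⟨R, hR, hR0, hRK, hRe, δ, hδ, hRpos⟩ := res h0 hγ hl hN hc
  set k := Ke γ l 0 with hk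
  set w : ℝ → ℝ := fun s => N - V s with hw
  have hwm : Measurable w := measurable_const.sub hV
  have hw1 : ∀ s, 1 ≤ w s := fun s => by
    have := (abs_le.1 (hVM s)).2
    simp only [hw]; linarith
  have hw2 : ∀ s, w s ≤ 2 * N := fun s => by
    have := (abs_le.1 (hVM s)).1
    simp only [hw]; linarith
  have hwb : ∀ s, |w s| ≤ 2 * N := fun s => by
    rw [abs_of_nonneg (by linarith [hw1 s])]; exact hw2 s
  have hRint : ∫ x, R x ≤ ∫ x, k x := integral_mono_ae hR hK hRK
  have hRabs : ∫ x, |R x| = ∫ x, R x := by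
    apply integral_congr_ae
    filter_upwards [hR0] with x hx using abs_of_nonneg hx
  have hcR : 2 * N * ∫ x, R x < 1 := by nlinarith
  obtain ⟨Y, hY, hYe⟩ := exists_sol (b := w) (c := 2 * N) (g := fun s => a * R s) hR hwm hwb
    (by rw [hRabs]; exact hcR) (hR.const_mul a)
  have hwY : Integrable (fun s => w s * Y s) := bmul_int hwm hwb hY
  have hVY : Integrable (fun s => V s * Y s) := bmul_int hV hVM hY
  -- nonnegativity
  have hY0 : ∀ᵐ t, 0 ≤ Y t := by
    have hd : Integrable (fun t => max (- Y t) 0) := hY.neg.pos_part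
    have hd0 : ∀ t, 0 ≤ max (- Y t) 0 := fun t => le_max_right _ _
    have hz : ∀ᵐ t, max (- Y t) 0 = 0 := by
      refine zero_of_le (c := 2 * N) hR hd hcR ?_
      have i1 : Integrable (fun s => 2 * N * |max (- Y s) 0|) := hd.abs.const_mul _
      have m1 := cv_mono_right (g := fun s => (-1) * (2 * N * |max (- Y s) 0|)) hR
        (i1.const_mul (-1)) hwY hR0 (Eventually.of_forall fun s => by
          rw [abs_of_nonneg (hd0 s)]
          have := hw1 s
          have := hw2 s
          rcases le_total 0 (Y s) with h | h
          · rw [max_eq_right (by linarith)]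
            have : 0 ≤ w s * Y s := mul_nonneg (by linarith) h
            linarith
          · rw [max_eq_left (by linarith)]
            nlinarith)
      have m2 := cv_mono_right (g := fun _ => 0) hR (integrable_zero _ _ _) i1 hR0
        (Eventually.of_forall fun s => by have := abs_nonneg (max (- Y s) 0); positivity)
      filter_upwards [m1, m2, hYe, hR0] with t h1 h2 h3 h4
      rw [cv_const_right] at h1
      have h2' : 0 ≤ cv R (fun s => 2 * N * |max (- Y s) 0|) t := by simpa [cv] using h2
      rw [abs_of_nonneg (hd0 t)]
      refine max_le ?_ h2'
      have : 0 ≤ a * R t := mul_nonneg ha.le h4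
      linarith
    filter_upwards [hz] with t ht
    have := le_max_left (- Y t) 0
    linarith
  have hwY0 : ∀ᵐ t, 0 ≤ w t * Y t := by
    filter_upwards [hY0] with t ht
    exact mul_nonneg (by linarith [hw1 t]) ht
  have hcv0 : ∀ᵐ t, 0 ≤ cv R (fun s => w s * Y s) t := by
    have := cv_mono_right (g := fun _ => 0) hR (integrable_zero _ _ _) hwY hR0 hwY0
    filter_upwards [this] with t ht
    simpa [cv] using ht
  refine ⟨Y, hY, ?_, ?_⟩
  · have c1 : cv k Y = cv k (fun s => a * R s + cv R (fun s => w s * Y s) s) :=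
      cv_congr (EventuallyEq.refl _ _) hYe
    have hkR := cv_int hK hR
    have c2 : cv k (fun s => w s * Y s) =
        cv (fun s => R s + N * cv k R s) (fun s => w s * Y s) := by
      refine cv_congr ?_ (EventuallyEq.refl _ _)
      filter_upwards [hRe] with t ht using ht.symm
    have c3 : (fun s => w s * Y s) = fun s => N * Y s - V s * Y s := by
      funext s; simp only [hw]; ring
    filter_upwards [hYe, hRe, cv_add_right hK (hR.const_mul a) (cv_int hR hwY),
      cv_assoc hK hR hwY, cv_add_left hR (hkR.const_mul N) hwY,
      cv_sub_right hK (hY.const_mul N) hVY] with t e1 e2 e3 e4 e5 e6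
    rw [← c1, cv_const_right] at e3
    rw [← c2, cv_const_left, e4] at e5
    rw [← c3, cv_const_right] at e6
    linear_combination e1 + a * e2 + N * e3 - e5 + e6
  · have P : ∀ n : ℕ, ∀ᵐ t, t ∈ Ioo 0 (((n:ℝ) + 1) * (δ / 2)) → 0 < Y t := by
      intro n
      induction n with
      | zero =>
        filter_upwards [hRpos, hYe, hcv0] with t h1 h2 h3 ht
        have h4 := h1 ⟨ht.1, by have := ht.2; norm_num at this; linarith⟩
        have : 0 < a * R t := mul_pos ha h4
        linarith
      | succ n ih =>
        filter_upwards [ih, hR0, hYe, cv_ae hR hwY] with t h1 h2 h3 h4 ht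
        rcases lt_or_ge t (((n:ℝ) + 1) * (δ / 2)) with h | h
        · exact h1 ⟨ht.1, h⟩
        have haR : 0 ≤ a * R t := mul_nonneg ha.le h2
        have q0 : ∀ᵐ s, 0 ≤ R (t - s) := (quasiMeasurePreserving_sub_left volume t).ae hR0
        have q1 : ∀ᵐ s, t - s ∈ Ioo 0 δ → 0 < R (t - s) :=
          (quasiMeasurePreserving_sub_left volume t).ae hRpos
        have hpos : 0 < cv R (fun s => w s * Y s) t := by
          unfold cv
          rw [integral_pos_iff_support_of_nonneg_ae ?_ h4]
          · have hJ : 0 < volume (Ioo (max 0 (t - δ)) (((n:ℝ) + 1) * (δ / 2))) := by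
              rw [Real.volume_Ioo, ENNReal.ofReal_pos, sub_pos]
              have h5 := ht.2
              push_cast at h5
              refine max_lt (by positivity) ?_
              nlinarith
            refine hJ.trans_le (measure_mono_ae ?_)
            filter_upwards [q1, ih] with s g1 g2 hs
            have hs1 : 0 < s := (le_max_left _ _).trans_lt hs.1
            have hs2 : t - δ < s := (le_max_right _ _).trans_lt hs.1
            have hs3 := hs.2
            have r1 := g1 ⟨by linarith, by linarith⟩
            have r2 := g2 ⟨hs1, hs3⟩
            have r3 := hw1 s
            have : 0 < R (t - s) * (w s * Y s) := mul_pos r1 (mul_pos (by linarith) r2)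
            exact this.ne'
          · filter_upwards [q0, hwY0] with s g1 g2 using mul_nonneg g1 g2
        linarith
    have hall := ae_all_iff.2 P
    filter_upwards [hall] with t ht h
    obtain ⟨n, hn⟩ := exists_nat_gt (t / (δ / 2))
    rw [div_lt_iff₀ (by positivity)] at hn
    exact ht n ⟨h, by nlinarith⟩

/-- relation between the weighted convolution and the Volterra integral -/
lemma bridge {γ l T : ℝ} {v : ℝ → ℝ} (z Z : ℝ → ℝ)
    (hZ : ∀ s, s ∈ Ioc 0 T → Z s = exp (-(l * s)) * z s) {t : ℝ} (ht : t ∈ Ioc 0 T) :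
    cv (Ke γ l 0) (fun s => (Ioc 0 T).indicator v s * Z s) t =
      exp (-(l * t)) * ∫ s in (0:ℝ)..t, (t - s) ^ (γ - 1) * v s * z s := by
  rw [← intervalIntegral.integral_const_mul, intervalIntegral.integral_of_le ht.1.le,
    ← integral_indicator measurableSet_Ioc]
  unfold cv
  congr 1
  funext s
  change Ke γ l 0 (t - s) * ((Ioc 0 T).indicator v s * Z s) = _
  by_cases hs : s ∈ Ioc 0 t
  · have hs' : s ∈ Ioc 0 T := ⟨hs.1, hs.2.trans ht.2⟩
    rw [indicator_of_mem hs, indicator_of_mem hs', hZ s hs', Ke_of_nonneg (sub_nonneg.2 hs.2),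
      add_zero]
    have : exp (-(l * t)) = exp (-(l * (t - s))) * exp (-(l * s)) := by
      rw [← exp_add]; congr 1; ring
    rw [this]; ring
  · rw [indicator_of_notMem hs]
    by_cases h0 : 0 < s
    · have : t < s := by
        by_contra hcon
        exact hs ⟨h0, not_lt.1 hcon⟩
      rw [Ke_of_neg (by linarith)]; simp
    · have : s ∉ Ioc 0 T := fun h => h0 h.1
      rw [indicator_of_notMem this]; simp

lemma exists_l {γ : ℝ} (h0 : 0 < γ) (hγ : γ < 1) {N : ℝ} (hN : 0 < N) :
    ∃ l > 0, N * ∫ x, Ke γ l 0 x ≤ 1 / 16 := by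
  have hG : 0 < Gamma γ := Gamma_pos_of_pos h0
  refine ⟨(16 * N * Gamma γ) ^ (1 / γ), by positivity, ?_⟩
  rw [Ke0_integral h0 hγ (by positivity), one_div, inv_rpow (by positivity), ← rpow_mul
    (by positivity), one_div_mul_cancel h0.ne', rpow_one]
  apply le_of_eq
  field_simp

end

/-- existence, uniqueness, and a.e. positivity of the solution of the
weakly singular Volterra integral equation
`y(t) + ∫₀ᵗ (t−s)^{γ−1} v(s) y(s) ds = a t^{γ−1}`. -/
theorem stmt4 (γ T a : ℝ) (v : ℝ → ℝ)
    (hγ : γ ∈ Set.Ioo (0:ℝ) 1) (hT : 0 < T)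
    (hv : ContinuousOn v (Set.Icc 0 T)) (ha : 0 < a) :
    ∃ y : ℝ → ℝ, IntegrableOn y (Set.Icc 0 T) ∧
      (∀ᵐ t ∂(volume.restrict (Set.Icc (0:ℝ) T)),
        y t + ∫ s in (0:ℝ)..t, (t - s) ^ (γ - 1) * v s * y s = a * t ^ (γ - 1)) ∧
      (∀ᵐ t ∂(volume.restrict (Set.Icc (0:ℝ) T)), 0 < y t) ∧
      (∀ z : ℝ → ℝ, IntegrableOn z (Set.Icc 0 T) →
        (∀ᵐ t ∂(volume.restrict (Set.Icc (0:ℝ) T)),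
          z t + ∫ s in (0:ℝ)..t, (t - s) ^ (γ - 1) * v s * z s = a * t ^ (γ - 1)) →
        (∀ᵐ t ∂(volume.restrict (Set.Icc (0:ℝ) T)), z t = y t)) := by
  obtain ⟨h0, h1⟩ := hγ
  obtain ⟨M, hM⟩ := isCompact_Icc.exists_bound_of_continuousOn hv
  have hM0 : 0 ≤ M := (norm_nonneg _).trans (hM 0 ⟨le_rfl, hT.le⟩)
  set V : ℝ → ℝ := (Ioc 0 T).indicator v with hVdef
  have hVm : Measurable V := by
    classical
    rw [hVdef, ← Set.piecewise_eq_indicator]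
    exact ContinuousOn.measurable_piecewise (hv.mono Ioc_subset_Icc_self) continuousOn_const
      measurableSet_Ioc
  have hVM : ∀ x, |V x| ≤ M := by
    intro x
    by_cases hx : x ∈ Ioc 0 T
    · rw [hVdef, indicator_of_mem hx]; exact hM x (Ioc_subset_Icc_self hx)
    · rw [hVdef, indicator_of_notMem hx]; simpa using hM0
  obtain ⟨l, hl, hc⟩ := exists_l h0 h1 (by linarith : 0 < M + 1)
  have hK := Ke0_int h0 h1 hl
  have hκ : 0 ≤ ∫ x, Ke γ l 0 x := integral_nonneg (Ke_nonneg le_rfl)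
  obtain ⟨Y, hY, hYe, hYp⟩ := sol h0 h1 hl ha hVm hVM hc
  have hee : ∀ s, exp (-(l * s)) * exp (l * s) = 1 := fun s => by
    rw [← exp_add]; simp
  have hKt : ∀ t, 0 < t → Ke γ l 0 t = exp (-(l * t)) * t ^ (γ - 1) := fun t ht => by
    rw [Ke_of_nonneg ht.le, add_zero, mul_comm]
  have hae : ∀ P : ℝ → Prop, (∀ᵐ t, t ∈ Ioc 0 T → P t) →
      ∀ᵐ t ∂(volume.restrict (Set.Icc (0:ℝ) T)), P t := by
    intro P h
    rw [← restrict_Ioc_eq_restrict_Icc]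
    exact (ae_restrict_iff' measurableSet_Ioc).2 h
  have hae' : ∀ P : ℝ → Prop, (∀ᵐ t ∂(volume.restrict (Set.Icc (0:ℝ) T)), P t) →
      ∀ᵐ t, t ∈ Ioc 0 T → P t := by
    intro P h
    rw [← restrict_Ioc_eq_restrict_Icc] at h
    exact (ae_restrict_iff' measurableSet_Ioc).1 h
  refine ⟨fun t => exp (l * t) * Y t, ?_, hae _ ?_, hae _ ?_, ?_⟩
  · exact (hY.integrableOn (s := Icc 0 T)).continuousOn_mul (by fun_prop) isCompact_Icc
  · filter_upwards [hYe] with t ht htT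
    rw [hVdef, bridge (fun t => exp (l * t) * Y t) Y
      (fun s _ => by rw [← mul_assoc, hee, one_mul]) htT, hKt t htT.1] at ht
    have h2 := hee t
    have := congrArg (fun x => exp (l * t) * x) ht
    linear_combination this - ((∫ s in (0:ℝ)..t, (t - s) ^ (γ - 1) * v s * (exp (l * s) * Y s)) -
      a * t ^ (γ - 1)) * h2
  · filter_upwards [hYp] with t ht htT
    exact mul_pos (exp_pos _) (ht htT.1)
  · intro z hz hze
    have hze' := hae' _ hze
    apply hae
    set Z : ℝ → ℝ := (Ioc 0 T).indicator (fun s => exp (-(l * s)) * z s) with hZ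
    have hZi : Integrable Z := by
      rw [hZ, integrable_indicator_iff measurableSet_Ioc]
      exact (hz.continuousOn_mul (g := fun s => exp (-(l * s))) (by fun_prop) isCompact_Icc).mono_set
        Ioc_subset_Icc_self
    set d : ℝ → ℝ := (Ioc 0 T).indicator (fun s => Z s - Y s) with hd
    have hdi : Integrable d := (hZi.sub hY).indicator measurableSet_Ioc
    have hVZ := bmul_int hVm hVM hZi
    have hVY := bmul_int hVm hVM hY
    have hVd := bmul_int hVm hVM hdi
    have hVde : (fun s => V s * d s) = fun s => V s * Z s - V s * Y s := by
      funext s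
      by_cases hs : s ∈ Ioc 0 T
      · rw [hd, indicator_of_mem hs]; ring
      · rw [hVdef, indicator_of_notMem hs]; ring
    have hzero : ∀ᵐ t, d t = 0 := by
      refine zero_of_le (c := M) hK hdi (by nlinarith) ?_
      have hKn : ∀ᵐ t, 0 ≤ Ke γ l 0 t := Eventually.of_forall (Ke_nonneg le_rfl)
      have m1 := cv_mono_right hK hVd.abs (hdi.abs.const_mul M) hKn
        (Eventually.of_forall fun s => by
          rw [abs_mul]; exact mul_le_mul_of_nonneg_right (hVM s) (abs_nonneg _))
      have m2 := cv_mono_right (g := fun _ => 0) hK (integrable_zero _ _ _) hVd.abs hKn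
        (Eventually.of_forall fun s => abs_nonneg _)
      filter_upwards [m1, m2, hYe, hze', cv_sub_right hK hVZ hVY] with t n1 n2 n3 n4 n5
      have n2' : 0 ≤ cv (Ke γ l 0) (fun s => |V s * d s|) t := by simpa [cv] using n2
      by_cases ht : t ∈ Ioc 0 T
      · have n6 := n4 ht
        have n7 : cv (Ke γ l 0) (fun s => V s * Z s) t =
            exp (-(l * t)) * ∫ s in (0:ℝ)..t, (t - s) ^ (γ - 1) * v s * z s :=
          bridge z Z (fun s hs => by rw [hZ, indicator_of_mem hs]) ht
        have n8 : Z t + cv (Ke γ l 0) (fun s => V s * Z s) t = a * Ke γ l 0 t := by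
          rw [n7, hKt t ht.1, hZ, indicator_of_mem ht]
          linear_combination exp (-(l * t)) * n6
        have n9 : d t = - cv (Ke γ l 0) (fun s => V s * d s) t := by
          rw [hVde, n5]
          have : d t = Z t - Y t := by rw [hd, indicator_of_mem ht]
          rw [this]
          linear_combination n8 - n3
        rw [n9, abs_neg]
        refine (cv_abs_le _ _ _).trans (le_trans (le_of_eq ?_) n1)
        congr 1
        funext s
        exact abs_of_nonneg (Ke_nonneg le_rfl s)
      · have : d t = 0 := by rw [hd, indicator_of_notMem ht]
        rw [this, abs_zero]
        exact n2'.trans n1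
    filter_upwards [hzero] with t ht htT
    rw [hd, indicator_of_mem htT, hZ, indicator_of_mem htT] at ht
    have := hee t
    linear_combination exp (l * t) * ht - z t * this
end
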